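/- arXiv:1010.4496 — 2 statements merged into one kernel-verified Lean document; each statement's English description precedes it below -/
import Mathlib

section
/- Let (K_n)_{n ≥ 0} be a decreasing sequence of compact subsets of ℂ, each equal to the closure of a Jordan domain containing 0, and let (r_n) be a decreasing sequence of positive reals with r_n → 0. Suppose that for every n ≥ 0: (a) d_H(K_n, ∂K_{n+1}) < r_n/2 and d_H(∂K_{n+1}, K_{n+1}) < r_{n+1}/2; and (b) for every cross-cut γ of ℂ ∖ K_{n+1} whose endpoints a, b satisfy dist(a, ∂K_n) < r_n, dist(b, ∂K_n) < r_n and |a − b| > r_n, one has K_{n+1} ⊆ N(closure(G(γ)), r_n), where G(γ) is computed relative to K_{n+1}. Then the compact set K_∞ = ⋂_{n ≥ 0} K_n satisfies: for every cross-cut γ of ℂ ∖ K_∞, K_∞ ⊆ closure(G(γ)), where G(γ) is computed relative to K_∞. -/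
open Complex Metric Set Filter

noncomputable section

/-- A Jordan domain: a bounded connected open subset of `ℂ` whose frontier is the
image of an injective continuous map from the unit circle. -/
def JordanDomain (W : Set ℂ) : Prop :=
  IsOpen W ∧ IsConnected W ∧ Bornology.IsBounded W ∧
    ∃ φ : Metric.sphere (0 : ℂ) 1 → ℂ, Continuous φ ∧ Function.Injective φ ∧
      Set.range φ = frontier W

/-- `γ : [0,1] → ℂ` is a cross-cut of `ℂ ∖ K`. -/
def CrossCut (K : Set ℂ) (γ : ℝ → ℂ) : Prop :=
  ContinuousOn γ (Set.Icc 0 1) ∧ Set.InjOn γ (Set.Icc 0 1) ∧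
    γ 0 ∈ K ∧ γ 1 ∈ K ∧ γ 0 ≠ γ 1 ∧ ∀ t ∈ Set.Ioo (0 : ℝ) 1, γ t ∉ K

/-- `G(γ)` computed relative to `K`: the union of the bounded connected components of
`ℂ ∖ (K ∪ γ([0,1]))`. -/
def CrossCutRegion (K : Set ℂ) (γ : ℝ → ℂ) : Set ℂ :=
  {z | z ∉ K ∪ γ '' Set.Icc 0 1 ∧
    Bornology.IsBounded (connectedComponentIn (K ∪ γ '' Set.Icc 0 1)ᶜ z)}

theorem CrossCut.inter_image {K : Set ℂ} {γ : ℝ → ℂ} (hγ : CrossCut K γ) :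
    K ∩ γ '' Icc 0 1 = {γ 0, γ 1} := by
  obtain ⟨-, -, h0, h1, -, hK⟩ := hγ
  refine Subset.antisymm ?_ ?_
  · rintro _ ⟨hzK, t, ht, rfl⟩
    rcases eq_endpoints_or_mem_Ioo_of_mem_Icc ht with rfl | rfl | ht
    · simp
    · simp
    · exact absurd hzK (hK t ht)
  · rintro z (rfl | rfl)
    · exact ⟨h0, mem_image_of_mem γ ⟨le_rfl, zero_le_one⟩⟩
    · exact ⟨h1, mem_image_of_mem γ ⟨zero_le_one, le_rfl⟩⟩

/-- `f` has a continuous logarithm on `X`. -/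
def HasLogOn (f : ℂ → ℂ) (X : Set ℂ) : Prop :=
  ∃ g : ℂ → ℂ, ContinuousOn g X ∧ ∀ x ∈ X, exp (g x) = f x

theorem HasLogOn.congr {f f' : ℂ → ℂ} {X : Set ℂ} (h : HasLogOn f X)
    (hf : ∀ x ∈ X, f x = f' x) : HasLogOn f' X := by
  obtain ⟨g, hg, he⟩ := h
  exact ⟨g, hg, fun x hx => (he x hx).trans (hf x hx)⟩

theorem HasLogOn.mul {f f' : ℂ → ℂ} {X : Set ℂ} (h : HasLogOn f X) (h' : HasLogOn f' X) :
    HasLogOn (fun x => f x * f' x) X := by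
  obtain ⟨g, hg, he⟩ := h
  obtain ⟨g', hg', he'⟩ := h'
  exact ⟨fun x => g x + g' x, hg.add hg', fun x hx => by rw [exp_add, he x hx, he' x hx]⟩

theorem HasLogOn.inv {f : ℂ → ℂ} {X : Set ℂ} (h : HasLogOn f X) :
    HasLogOn (fun x => (f x)⁻¹) X := by
  obtain ⟨g, hg, he⟩ := h
  exact ⟨fun x => -g x, hg.neg, fun x hx => by rw [exp_neg, he x hx]⟩

/-- A continuous nonvanishing function on a simply connected space has a logarithm. -/
theorem exists_log_of_simplyConnected {E : Type*} [TopologicalSpace E] [SimplyConnectedSpace E]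
    [LocallyPathConnectedSpace E] {f : E → ℂ} (hf : Continuous f) (h0 : ∀ x, f x ≠ 0) :
    ∃ g : E → ℂ, Continuous g ∧ ∀ x, exp (g x) = f x := by
  obtain ⟨x₀⟩ : Nonempty E := inferInstance
  rcases isCoveringMapOn_exp.existsUnique_continuousMap_lifts ⟨f, hf⟩ (a₀ := x₀)
    (e₀ := Complex.log (f x₀)) (exp_log (h0 x₀)) (fun x => h0 x) with ⟨g, ⟨-, hg⟩, -⟩
  exact ⟨g, g.continuous, fun x => congrFun hg x⟩

theorem isDiscrete_two_pi_I_int : IsDiscrete (range fun n : ℤ => (n : ℂ) * (2 * Real.pi * I)) := by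
  rw [isDiscrete_iff_discreteTopology]
  refine DiscreteTopology.of_forall_le_dist (r := 1) one_pos ?_
  rintro ⟨_, n, rfl⟩ ⟨_, m, rfl⟩ hnm
  have hnm' : n ≠ m := by
    rintro rfl
    exact hnm rfl
  rw [Subtype.dist_eq, dist_eq_norm]
  have : (n : ℂ) * (2 * Real.pi * I) - m * (2 * Real.pi * I) =
      ((n - m : ℤ) : ℂ) * (2 * Real.pi * I) := by push_cast; ring
  simp only [this]
  rw [norm_mul, norm_mul, norm_mul, norm_intCast, norm_I, norm_real]
  have h2 : (1 : ℝ) ≤ |((n - m : ℤ) : ℝ)| := by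
    exact_mod_cast Int.one_le_abs (sub_ne_zero.2 hnm')
  have h3 := Real.pi_gt_three
  rw [Real.norm_of_nonneg Real.pi_pos.le]
  norm_num
  push_cast at h2
  nlinarith

/-- Two logarithms of the same function on a preconnected set differ by a constant. -/
theorem log_sub_log_const {E : Type*} [TopologicalSpace E] {S : Set E} (hS : IsPreconnected S)
    {g h : E → ℂ} (hg : ContinuousOn g S) (hh : ContinuousOn h S)
    (he : ∀ x ∈ S, exp (g x) = exp (h x)) {x y : E} (hx : x ∈ S) (hy : y ∈ S) :
    g x - h x = g y - h y := by
  refine hS.constant_of_mapsTo isDiscrete_two_pi_I_int (f := fun x => g x - h x) (hg.sub hh)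
    (fun z hz => ?_) hx hy
  obtain ⟨n, hn⟩ := exp_eq_exp_iff_exists_int.1 (he z hz)
  exact ⟨n, by simp [hn]⟩

/-- Logarithms on two sets with preconnected intersection have a common extension, up to an
additive constant. -/
theorem HasLogOn.exists_common {f : ℂ → ℂ} {A B : Set ℂ} (hA : HasLogOn f A) (hB : HasLogOn f B)
    (hAB : IsPreconnected (A ∩ B)) :
    ∃ g : ℂ → ℂ, ContinuousOn g A ∧ ContinuousOn g B ∧ ∀ x ∈ A ∪ B, exp (g x) = f x := by
  classical
  obtain ⟨g, hg, hge⟩ := hA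
  obtain ⟨h, hh, hhe⟩ := hB
  obtain ⟨c, hc1, hc⟩ : ∃ c : ℂ, exp c = 1 ∧ ∀ x ∈ A ∩ B, g x = h x + c := by
    rcases (A ∩ B).eq_empty_or_nonempty with h0 | ⟨x₀, hx₀⟩
    · exact ⟨0, by simp, by simp [h0]⟩
    · refine ⟨g x₀ - h x₀, ?_, fun x hx => ?_⟩
      · rw [exp_sub, hge _ hx₀.1, hhe _ hx₀.2, div_self]
        rw [← hge _ hx₀.1]; exact exp_ne_zero _
      · have := log_sub_log_const hAB (hg.mono inter_subset_left) (hh.mono inter_subset_right)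
          (fun x hx => (hge x hx.1).trans (hhe x hx.2).symm) hx hx₀
        rw [← this]; ring
  have e1 : EqOn (A.piecewise g fun x => h x + c) g A := fun x hx => by simp [hx]
  have e2 : EqOn (A.piecewise g fun x => h x + c) (fun x => h x + c) B := fun x hx => by
    by_cases hxA : x ∈ A
    · simp [hxA, hc x ⟨hxA, hx⟩]
    · simp [hxA]
  refine ⟨A.piecewise g fun x => h x + c, hg.congr e1, (hh.add continuousOn_const).congr e2, ?_⟩
  rintro x (hx | hx)
  · rw [e1 hx, hge x hx]
  · rw [e2 hx, exp_add, hc1, mul_one, hhe x hx]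

/-- Logarithms glue along two closed sets with preconnected intersection. -/
theorem HasLogOn.union {f : ℂ → ℂ} {A B : Set ℂ} (hA : HasLogOn f A) (hB : HasLogOn f B)
    (hAc : IsClosed A) (hBc : IsClosed B) (hAB : IsPreconnected (A ∩ B)) :
    HasLogOn f (A ∪ B) := by
  obtain ⟨g, hgA, hgB, he⟩ := hA.exists_common hB hAB
  exact ⟨g, hgA.union_of_isClosed hgB hAc hBc, he⟩

/-- A logarithm along a loop of winding number `m` around a circle forces `m = 0`. -/
theorem winding_eq_zero {ℓ : ℝ → ℂ} {c : ℂ} {m : ℤ} (hℓ : Continuous ℓ)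
    (hp : ℓ (2 * Real.pi) = ℓ 0) (he : ∀ θ : ℝ, exp (ℓ θ) = c * exp (m * (θ * I))) : m = 0 := by
  have hc : c ≠ 0 := by
    rintro rfl
    exact exp_ne_zero _ ((he 0).trans (by simp))
  have := log_sub_log_const (isPreconnected_univ (α := ℝ)) hℓ.continuousOn
    (h := fun θ : ℝ => Complex.log c + m * (θ * I)) (by fun_prop)
    (fun θ _ => by rw [he, exp_add, exp_log hc]) (mem_univ (2 * Real.pi)) (mem_univ 0)
  rw [hp] at this
  have h2 : (m : ℂ) * (2 * Real.pi * I) = 0 := by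
    push_cast at this
    linear_combination -this
  simpa [Real.pi_ne_zero] using h2

/-- Continuous functions constant on the fibres of a map from a compact set descend to its image. -/
theorem exists_descend {E F : Type*} [TopologicalSpace E] [TopologicalSpace F] [T2Space F]
    {S : Set E} (hS : IsCompact S) {f : E → F} (hf : ContinuousOn f S) {g : E → ℂ}
    (hg : ContinuousOn g S) (hfg : ∀ s ∈ S, ∀ t ∈ S, f s = f t → g s = g t) :
    ∃ h : F → ℂ, ContinuousOn h (f '' S) ∧ ∀ s ∈ S, h (f s) = g s := by
  classical
  have key : ∀ y : f '' S, ∃ s ∈ S, f s = y := fun y => y.2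
  choose σ hσS hσ using key
  refine ⟨fun y => if hy : y ∈ f '' S then g (σ ⟨y, hy⟩) else 0, ?_, ?_⟩
  · rw [continuousOn_iff_continuous_domRestrict]
    have : CompactSpace S := isCompact_iff_compactSpace.1 hS
    let q : S → f '' S := fun s => ⟨f s, mem_image_of_mem f s.2⟩
    have hq : Continuous q := by
      refine Continuous.subtype_mk ?_ _
      exact continuousOn_iff_continuous_domRestrict.1 hf
    have hqs : Function.Surjective q := by
      rintro ⟨_, s, hs, rfl⟩
      exact ⟨⟨s, hs⟩, rfl⟩
    have hqq : Topology.IsQuotientMap q := (hq.isClosedMap).isQuotientMap hq hqs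
    rw [hqq.continuous_iff]
    have : (S.domRestrict g) = (domRestrict (f '' S) fun y =>
        if hy : y ∈ f '' S then g (σ ⟨y, hy⟩) else 0) ∘ q := by
      ext s
      simp only [Function.comp, domRestrict_apply]
      rw [dif_pos (q s).2]
      exact hfg _ s.2 _ (hσS _) (hσ (q s)).symm
    rw [← this]
    exact continuousOn_iff_continuous_domRestrict.1 hg
  · intro s hs
    have hy : f s ∈ f '' S := mem_image_of_mem f hs
    simp only [dif_pos hy]
    exact hfg _ (hσS _) _ hs (hσ _)

theorem frontier_connectedComponentIn_subset {F : Set ℂ} (hF : IsOpen F) (x : ℂ) :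
    frontier (connectedComponentIn F x) ⊆ Fᶜ := by
  intro y hy hyF
  have hO : IsOpen (connectedComponentIn F x) := hF.connectedComponentIn
  rw [hO.frontier_eq] at hy
  have hOy : IsOpen (connectedComponentIn F y) := hF.connectedComponentIn
  obtain ⟨z, hz1, hz2⟩ := mem_closure_iff.1 hy.1 _ hOy (mem_connectedComponentIn hyF)
  apply hy.2
  rw [connectedComponentIn_eq hz2, ← connectedComponentIn_eq hz1]
  exact mem_connectedComponentIn hyF

theorem isPreconnected_norm_gt {R : ℝ} (hR : 0 < R) : IsPreconnected {x : ℂ | R < ‖x‖} := by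
  have h : {x : ℂ | R < ‖x‖} = Complex.exp '' {z : ℂ | Real.log R < z.re} := by
    ext x
    constructor
    · intro hx
      have hx' : R < ‖x‖ := hx
      have h0 : x ≠ 0 := by
        rintro rfl
        simp at hx'
        linarith
      refine ⟨Complex.log x, ?_, exp_log h0⟩
      simp only [mem_ofPred_eq, log_re]
      exact Real.log_lt_log hR hx
    · rintro ⟨z, hz, rfl⟩
      simp only [mem_ofPred_eq, norm_exp] at hz ⊢
      rw [← Real.exp_log hR]
      exact Real.exp_lt_exp.2 hz
  rw [h]
  exact (convex_halfSpace_re_gt _).isPreconnected.image _ continuous_exp.continuousOn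

theorem isBounded_connectedComponentIn_or {X : Set ℂ} {R : ℝ} (hR : 0 < R)
    (hX : ∀ x ∈ X, ‖x‖ ≤ R) (p : ℂ) :
    Bornology.IsBounded (connectedComponentIn Xᶜ p) ∨
      ∀ q, R < ‖q‖ → q ∈ connectedComponentIn Xᶜ p := by
  by_cases hb : ∀ x ∈ connectedComponentIn Xᶜ p, ‖x‖ ≤ R
  · exact Or.inl (isBounded_iff_forall_norm_le.2 ⟨R, hb⟩)
  · push Not at hb
    obtain ⟨x, hx, hxR⟩ := hb
    right
    intro q hq
    rw [connectedComponentIn_eq hx]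
    have hsub : {y : ℂ | R < ‖y‖} ⊆ Xᶜ := fun y hy hyX => absurd (hX y hyX) (not_le.2 hy)
    exact (isPreconnected_norm_gt hR).subset_connectedComponentIn hxR hsub hq

theorem not_isBounded_of_forall_norm_gt {O : Set ℂ} {R : ℝ} (h : ∀ q : ℂ, R < ‖q‖ → q ∈ O) :
    ¬ Bornology.IsBounded O := by
  intro hb
  obtain ⟨C, hC⟩ := isBounded_iff_forall_norm_le.1 hb
  have h1 : ‖((|R| + |C| + 1 : ℝ) : ℂ)‖ = |R| + |C| + 1 := by
    rw [norm_real, Real.norm_of_nonneg (by positivity)]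
  have := hC _ (h ((|R| + |C| + 1 : ℝ) : ℂ) (by rw [h1]; linarith [le_abs_self R, abs_nonneg C]))
  rw [h1] at this
  linarith [le_abs_self C, abs_nonneg R]

/-- A nonvanishing continuous function on the plane that agrees with `(x - p) ^ m` outside a
bounded set has `m = 0`. -/
theorem exponent_eq_zero_of_eq_outside {H : ℂ → ℂ} (hH : Continuous H) (h0 : ∀ x, H x ≠ 0)
    {O : Set ℂ} (hO : Bornology.IsBounded O) {p : ℂ} {m : ℤ}
    (hm : ∀ x ∉ O, H x = (x - p) ^ m) : m = 0 := by
  obtain ⟨g, hg, he⟩ := exists_log_of_simplyConnected hH h0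
  obtain ⟨R, hR, hOR⟩ := hO.subset_ball_lt 0 p
  refine winding_eq_zero (ℓ := fun θ => g (circleMap p R θ)) (c := (R : ℂ) ^ m) (by fun_prop)
    ?_ fun θ => ?_
  · simp [circleMap]
  · rw [he, hm, circleMap_sub_center, circleMap, zero_add, mul_zpow, ← exp_int_mul]
    intro h
    have := mem_ball.1 (hOR h)
    rw [dist_eq_norm, circleMap_sub_center, norm_circleMap_zero, abs_of_pos hR] at this
    exact lt_irrefl _ this

/-- The extension principle: if `(x - p) ^ m / f` has a logarithm on a compact set containing the
frontier of a bounded open set, where `f` does not vanish on its closure, then `m = 0`. -/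
theorem exponent_eq_zero_of_log {O X : Set ℂ} (hO : IsOpen O) (hOb : Bornology.IsBounded O)
    (hX : IsCompact X) (hOX : frontier O ⊆ X) {p : ℂ} (hp : p ∈ O) {f : ℂ → ℂ} {m : ℤ}
    (hf : ContinuousOn f (closure O)) (hf0 : ∀ x ∈ O, f x ≠ 0)
    {g : ℂ → ℂ} (hg : ContinuousOn g X) (he : ∀ x ∈ X, exp (g x) * f x = (x - p) ^ m) :
    m = 0 := by
  classical
  obtain ⟨G, hG⟩ := ContinuousMap.exists_restrict_eq hX.isClosed
    ⟨_, continuousOn_iff_continuous_domRestrict.1 hg⟩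
  have hGg : ∀ x ∈ X, G x = g x := fun x hx => congrFun (congrArg DFunLike.coe hG) ⟨x, hx⟩
  refine exponent_eq_zero_of_eq_outside
    (H := O.piecewise (fun x => exp (G x) * f x) (fun x => (x - p) ^ m)) ?_ ?_ hOb
    (p := p) (m := m) ?_
  · refine continuous_piecewise ?_ ?_ ?_
    · intro a ha
      simp only [hGg a (hOX ha), he a (hOX ha)]
    · exact (continuous_exp.comp G.continuous).continuousOn.mul hf
    · rw [hO.isClosed_compl.closure_eq]
      refine ContinuousOn.zpow₀ (by fun_prop) _ fun x hx => Or.inl (sub_ne_zero.2 ?_)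
      rintro rfl
      exact hx hp
  · intro x
    by_cases hx : x ∈ O
    · simp only [piecewise_eq_of_mem _ _ _ hx]
      exact mul_ne_zero (exp_ne_zero _) (hf0 x hx)
    · rw [piecewise_eq_of_notMem _ _ _ hx]
      refine zpow_ne_zero _ (sub_ne_zero.2 ?_)
      rintro rfl
      exact hx hp
  · intro x hx
    rw [piecewise_eq_of_notMem _ _ _ hx]

theorem not_hasLogOn_of_isBounded {X : Set ℂ} (hX : IsCompact X) {p q : ℂ} (hp : p ∉ X)
    (hb : Bornology.IsBounded (connectedComponentIn Xᶜ p))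
    (hpq : q ∉ connectedComponentIn Xᶜ p) (hq : q ∉ X) :
    ¬ HasLogOn (fun x => (x - p) / (x - q)) X := by
  rintro ⟨g, hg, he⟩
  have := exponent_eq_zero_of_log hX.isClosed.isOpen_compl.connectedComponentIn hb hX
    (by simpa using frontier_connectedComponentIn_subset hX.isClosed.isOpen_compl p)
    (mem_connectedComponentIn hp) (f := fun x => x - q) (m := 1) (by fun_prop)
    (fun x hx h => hpq (by rwa [← sub_eq_zero.1 h])) hg fun x hx => by
      have : x - q ≠ 0 := sub_ne_zero.2 (by rintro rfl; exact hq hx)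
      rw [he x hx, zpow_one, div_mul_cancel₀ _ this]
  exact one_ne_zero this

/-- If `(x - p) / (x - q)` has a logarithm on a compact set, then this set does not separate
`p` from `q`. -/
theorem HasLogOn.mem_connectedComponentIn {X : Set ℂ} (hX : IsCompact X) {p q : ℂ} (hp : p ∉ X)
    (hq : q ∉ X) (h : HasLogOn (fun x => (x - p) / (x - q)) X) :
    q ∈ connectedComponentIn Xᶜ p := by
  by_contra hpq
  obtain ⟨R, hR, hXR⟩ := hX.isBounded.exists_pos_norm_le
  rcases isBounded_connectedComponentIn_or hR hXR p with hb | hfar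
  · exact not_hasLogOn_of_isBounded hX hp hb hpq hq h
  rcases isBounded_connectedComponentIn_or hR hXR q with hb | hfar'
  · refine not_hasLogOn_of_isBounded hX hq hb (fun hqp => hpq ?_) hp
      (h.inv.congr fun x _ => by simp)
    rw [← connectedComponentIn_eq hqp]
    exact _root_.mem_connectedComponentIn hq
  · have h1 : R < ‖((R + 1 : ℝ) : ℂ)‖ := by
      rw [norm_real, Real.norm_of_nonneg (by positivity)]; linarith
    apply hpq
    rw [connectedComponentIn_eq (hfar _ h1), ← connectedComponentIn_eq (hfar' _ h1)]
    exact _root_.mem_connectedComponentIn hq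

theorem hasLogOn_div_of_dist_lt {X : Set ℂ} {y z : ℂ} (h : ∀ x ∈ X, dist y z < dist x y) :
    HasLogOn (fun x => (x - z) / (x - y)) X := by
  have hne : ∀ x ∈ X, x - y ≠ 0 := fun x hx => by
    rw [sub_ne_zero, ← dist_pos]
    exact dist_nonneg.trans_lt (h x hx)
  have hslit : ∀ x ∈ X, (x - z) / (x - y) ∈ slitPlane := by
    intro x hx
    have hxy := hne x hx
    have h1 : (x - z) / (x - y) = 1 + (y - z) / (x - y) := by field_simp; ring
    rw [h1]
    apply mem_slitPlane_of_norm_lt_one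
    rw [norm_div, div_lt_one (norm_pos_iff.2 hxy), ← dist_eq_norm, ← dist_eq_norm]
    exact h x hx
  refine ⟨fun x => Complex.log ((x - z) / (x - y)), ?_, fun x hx => ?_⟩
  · exact ContinuousOn.clog (ContinuousOn.div (by fun_prop) (by fun_prop) hne) hslit
  · exact exp_log (slitPlane_ne_zero (hslit x hx))

/-- If a compact set does not separate `p` from `q`, then `(x - p) / (x - q)` has a logarithm
on it. -/
theorem hasLogOn_of_mem_connectedComponentIn {X : Set ℂ} (hX : IsCompact X) {p q : ℂ}
    (h : q ∈ connectedComponentIn Xᶜ p) : HasLogOn (fun x => (x - p) / (x - q)) X := by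
  have hp : p ∈ Xᶜ := by
    by_contra hp
    rw [connectedComponentIn_eq_empty hp] at h
    exact h
  have hsub := connectedComponentIn_subset Xᶜ p
  refine isPreconnected_connectedComponentIn.induction₂
    (fun a b => HasLogOn (fun x => (x - a) / (x - b)) X) ?_ ?_ ?_
    (_root_.mem_connectedComponentIn hp) h
  · intro y hy
    obtain ⟨ε, hε, hball⟩ := Metric.isOpen_iff.1 hX.isClosed.isOpen_compl y (hsub hy)
    filter_upwards [mem_nhdsWithin_of_mem_nhds (Metric.ball_mem_nhds y hε)] with z hz
    have hlog := hasLogOn_div_of_dist_lt (X := X) (y := y) (z := z) fun x hx => by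
      rw [dist_comm y z]
      refine lt_of_lt_of_le hz ?_
      by_contra! hlt
      exact hball hlt hx
    exact hlog.inv.congr fun x _ => by simp
  · intro a b c ha hb hc hab hbc
    refine (hab.mul hbc).congr fun x hx => ?_
    have hxb : x - b ≠ 0 := sub_ne_zero.2 (by rintro rfl; exact hsub hb hx)
    field_simp
  · intro a b ha hb hab
    exact hab.inv.congr fun x _ => by simp

/-- Janiszewski's theorem: two compact sets with preconnected intersection, neither of which
separates `p` from `q`, have a union that does not separate `p` from `q`. -/
theorem janiszewski {A B : Set ℂ} (hA : IsCompact A) (hB : IsCompact B)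
    (hAB : IsPreconnected (A ∩ B)) {p q : ℂ} (h1 : q ∈ connectedComponentIn Aᶜ p)
    (h2 : q ∈ connectedComponentIn Bᶜ p) : q ∈ connectedComponentIn (A ∪ B)ᶜ p := by
  have hpA : p ∉ A := fun h => by
    rw [connectedComponentIn_eq_empty (by simpa using h)] at h1
    exact h1
  have hpB : p ∉ B := fun h => by
    rw [connectedComponentIn_eq_empty (by simpa using h)] at h2
    exact h2
  have hqA := connectedComponentIn_subset _ _ h1
  have hqB := connectedComponentIn_subset _ _ h2
  exact ((hasLogOn_of_mem_connectedComponentIn hA h1).union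
    (hasLogOn_of_mem_connectedComponentIn hB h2) hA.isClosed hB.isClosed
    hAB).mem_connectedComponentIn (hA.union hB) (by simp [hpA, hpB])
      (by simpa using ⟨hqA, hqB⟩)

/-- An arc does not separate the plane. -/
theorem isPreconnected_compl_arc {f : ℝ → ℂ} {a b : ℝ} (hf : ContinuousOn f (Icc a b))
    (hi : InjOn f (Icc a b)) : IsPreconnected (f '' Icc a b)ᶜ := by
  have hX : IsCompact (f '' Icc a b) := isCompact_Icc.image_of_continuousOn hf
  refine isPreconnected_of_forall_pair fun p hp q hq => ?_
  refine ⟨connectedComponentIn (f '' Icc a b)ᶜ p, connectedComponentIn_subset _ _,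
    mem_connectedComponentIn hp, ?_, isPreconnected_connectedComponentIn⟩
  rcases lt_or_ge b a with hab | hab
  · simp [hab, connectedComponentIn_univ]
  refine HasLogOn.mem_connectedComponentIn hX hp hq ?_
  have hne : ∀ {z}, z ∈ (f '' Icc a b)ᶜ → ∀ t ∈ Icc a b, f t - z ≠ 0 := fun hz t ht h =>
    hz ⟨t, ht, sub_eq_zero.1 h⟩
  have hc : ContinuousOn (fun t => (f t - p) / (f t - q)) (Icc a b) :=
    (hf.sub continuousOn_const).div (hf.sub continuousOn_const) (hne hq)
  obtain ⟨g, hg, he⟩ := exists_log_of_simplyConnected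
    (f := IccExtend hab ((Icc a b).domRestrict fun t => (f t - p) / (f t - q)))
    (continuousOn_iff_continuous_domRestrict.1 hc).Icc_extend' (fun x => by
      simp only [IccExtend, Function.comp, domRestrict_apply]
      exact div_ne_zero (hne hp _ (projIcc a b hab x).2) (hne hq _ (projIcc a b hab x).2))
  obtain ⟨h, hh, hhe⟩ := exists_descend isCompact_Icc hf (g := g) hg.continuousOn
    (fun s hs t ht hst => by rw [hi hs ht hst])
  refine ⟨h, hh, ?_⟩
  rintro _ ⟨t, ht, rfl⟩
  rw [hhe t ht, he, IccExtend_of_mem _ _ ht]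
  rfl

theorem connectedComponentIn_trans {F : Set ℂ} {x y z : ℂ} (h : y ∈ connectedComponentIn F x)
    (h' : z ∈ connectedComponentIn F y) : z ∈ connectedComponentIn F x := by
  rwa [connectedComponentIn_eq h]

theorem mem_of_mem_connectedComponentIn {F : Set ℂ} {x y : ℂ} (h : y ∈ connectedComponentIn F x) :
    x ∈ F := by
  by_contra hx
  rw [connectedComponentIn_eq_empty hx] at h
  exact h

theorem connectedComponentIn_symm {F : Set ℂ} {x y : ℂ} (h : y ∈ connectedComponentIn F x) :
    x ∈ connectedComponentIn F y := by
  rw [← connectedComponentIn_eq h]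
  exact mem_connectedComponentIn (mem_of_mem_connectedComponentIn h)

theorem setOf_lt_infDist_subset {C : Set ℂ} {ε ε' : ℝ} (h : ε ≤ ε') :
    {z | ε' < infDist z C} ⊆ {z | ε < infDist z C} := by
  intro z hz
  simp only [mem_ofPred_eq] at hz ⊢
  exact h.trans_lt hz

/-- Points in the connected complement of a closed set can be joined at positive distance from
this set. -/
theorem exists_infDist_joined {C : Set ℂ} (hC : IsClosed C) (hne : C.Nonempty)
    (hcc : IsPreconnected Cᶜ) {x y : ℂ} (hx : x ∉ C) (hy : y ∉ C) :
    ∃ ε > 0, y ∈ connectedComponentIn {z | ε < infDist z C} x := by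
  refine hcc.induction₂
    (fun x y => ∃ ε > 0, y ∈ connectedComponentIn {z | ε < infDist z C} x) ?_ ?_ ?_ hx hy
  · intro z hz
    have hpos : 0 < infDist z C := (hC.notMem_iff_infDist_pos hne).1 hz
    filter_upwards [mem_nhdsWithin_of_mem_nhds (ball_mem_nhds z (half_pos hpos))] with w hw
    refine ⟨infDist z C / 2, half_pos hpos, ?_⟩
    have hsub : ball z (infDist z C / 2) ⊆ {u | infDist z C / 2 < infDist u C} := by
      intro u hu
      have h1 := infDist_le_infDist_add_dist (s := C) (x := z) (y := u)
      have h2 := mem_ball'.1 hu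
      simp only [mem_ofPred_eq]
      linarith
    exact isPreconnected_ball.subset_connectedComponentIn (mem_ball_self (half_pos hpos)) hsub hw
  · rintro x y z - - - ⟨ε, hε, h⟩ ⟨ε', hε', h'⟩
    refine ⟨min ε ε', lt_min hε hε', connectedComponentIn_trans (y := y) ?_ ?_⟩
    · exact connectedComponentIn_mono _ (setOf_lt_infDist_subset (min_le_left _ _)) h
    · exact connectedComponentIn_mono _ (setOf_lt_infDist_subset (min_le_right _ _)) h'
  · rintro x y - - ⟨ε, hε, h⟩
    exact ⟨ε, hε, connectedComponentIn_symm h⟩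

/-- If `a` and `b` lie in a closed connected set `C` with connected complement, then
`(x - a) / (x - b)` has a logarithm on this complement. -/
theorem hasLogOn_compl {C : Set ℂ} (hC : IsClosed C) (hCc : IsPreconnected C)
    (hcc : IsPreconnected Cᶜ) {a b : ℂ} (ha : a ∈ C) (hb : b ∈ C) :
    HasLogOn (fun x => (x - a) / (x - b)) Cᶜ := by
  classical
  rcases Cᶜ.eq_empty_or_nonempty with h0 | ⟨x₀, hx₀⟩
  · exact ⟨0, by simp [h0], by simp [h0]⟩
  have hopen : ∀ ε : ℝ, IsOpen {z | ε < infDist z C} := fun ε =>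
    isOpen_lt continuous_const (continuous_infDist_pt C)
  have hlog : ∀ n : ℕ,
      HasLogOn (fun x => (x - a) / (x - b)) {z | 1 / ((n : ℝ) + 1) < infDist z C} := by
    intro n
    have hn : (0 : ℝ) < 1 / ((n : ℝ) + 1) := by positivity
    have hne : ∀ c ∈ C, ∀ x ∈ {z | 1 / ((n : ℝ) + 1) < infDist z C}, x - c ≠ 0 := by
      rintro c hc x hx h
      rw [sub_eq_zero.1 h] at hx
      have : 1 / ((n : ℝ) + 1) < infDist c C := hx
      rw [infDist_zero_of_mem hc] at this
      linarith
    refine hCc.induction₂ (fun a b => HasLogOn (fun x => (x - a) / (x - b))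
      {z | 1 / ((n : ℝ) + 1) < infDist z C}) ?_ ?_ ?_ ha hb
    · intro y hy
      filter_upwards [mem_nhdsWithin_of_mem_nhds (ball_mem_nhds y hn)] with z hz
      have := hasLogOn_div_of_dist_lt (X := {z | 1 / ((n : ℝ) + 1) < infDist z C})
        (y := y) (z := z) fun x hx =>
          ((mem_ball'.1 hz).trans hx).trans_le (infDist_le_dist_of_mem hy)
      exact this.inv.congr fun x _ => by simp
    · intro a b c ha hb hc hab hbc
      refine (hab.mul hbc).congr fun x hx => ?_
      have hxb := hne b hb x hx
      field_simp
    · intro a b ha hb hab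
      exact hab.inv.congr fun x _ => by simp
  choose ℓ hℓ hℓe using hlog
  beta_reduce at hℓe
  set Ω : ℕ → Set ℂ := fun n => connectedComponentIn {z | 1 / ((n : ℝ) + 1) < infDist z C} x₀
    with hΩ
  have hΩo : ∀ n, IsOpen (Ω n) := fun n => (hopen _).connectedComponentIn
  have hΩsub : ∀ n, Ω n ⊆ {z | 1 / ((n : ℝ) + 1) < infDist z C} := fun n =>
    connectedComponentIn_subset _ _
  have hΩmono : ∀ m n, m ≤ n → Ω m ⊆ Ω n := fun m n hmn =>
    connectedComponentIn_mono _ (setOf_lt_infDist_subset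
      (one_div_le_one_div_of_le (by positivity) (by simpa using hmn)))
  have hcover : ∀ y ∈ Cᶜ, ∃ n, y ∈ Ω n := by
    intro y hy
    obtain ⟨ε, hε, h⟩ := exists_infDist_joined hC ⟨a, ha⟩ hcc hx₀ hy
    obtain ⟨n, hn⟩ := exists_nat_one_div_lt hε
    exact ⟨n, connectedComponentIn_mono _ (setOf_lt_infDist_subset hn.le) h⟩
  set g : ℕ → ℂ → ℂ := fun n x => ℓ n x - ℓ n x₀ + Complex.log ((x₀ - a) / (x₀ - b)) with hg
  have hgc : ∀ n, ContinuousOn (g n) (Ω n) := fun n =>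
    (((hℓ n).mono (hΩsub n)).sub continuousOn_const).add continuousOn_const
  have hge : ∀ n, ∀ x ∈ Ω n, exp (g n x) = (x - a) / (x - b) := by
    intro n x hx
    have hx₀n := mem_of_mem_connectedComponentIn hx
    have hne : (x₀ - a) / (x₀ - b) ≠ 0 := by
      exact (hℓe n x₀ hx₀n).symm ▸ exp_ne_zero _
    rw [hg]
    simp only
    rw [exp_add, exp_sub, hℓe n x (hΩsub n hx), hℓe n x₀ hx₀n, exp_log hne, div_mul_cancel₀ _ hne]
  have hgg : ∀ m n, m ≤ n → ∀ x ∈ Ω m, g m x = g n x := by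
    intro m n hmn x hx
    have hx₀m : x₀ ∈ Ω m := mem_connectedComponentIn (mem_of_mem_connectedComponentIn hx)
    have := log_sub_log_const (S := Ω m) isPreconnected_connectedComponentIn (hgc m)
      ((hgc n).mono (hΩmono m n hmn))
      (fun z hz => (hge m z hz).trans (hge n z (hΩmono m n hmn hz)).symm) hx hx₀m
    have h0 : g m x₀ - g n x₀ = 0 := by simp [hg]
    exact sub_eq_zero.1 (this.trans h0)
  have hG : ∀ n, ∀ x ∈ Ω n, (if h : ∃ n, x ∈ Ω n then g (Nat.find h) x else 0) = g n x := by
    intro n x hx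
    have h : ∃ n, x ∈ Ω n := ⟨n, hx⟩
    rw [dif_pos h]
    exact hgg _ _ (Nat.find_min' h hx) x (Nat.find_spec h)
  refine ⟨fun x => if h : ∃ n, x ∈ Ω n then g (Nat.find h) x else 0, ?_, ?_⟩
  · intro x hx
    obtain ⟨n, hn⟩ := hcover x hx
    have : ContinuousAt (g n) x := (hgc n).continuousAt ((hΩo n).mem_nhds hn)
    refine (this.congr ?_).continuousWithinAt
    filter_upwards [(hΩo n).mem_nhds hn] with y hy
    exact (hG n y hy).symm
  · intro x hx
    obtain ⟨n, hn⟩ := hcover x hx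
    simp only [hG n x hn, hge n x hn]

theorem not_hasLogOn_compl_pair {a b : ℂ} (hab : a ≠ b) :
    ¬ HasLogOn (fun x => (x - a) / (x - b)) {a, b}ᶜ := by
  rintro ⟨g, hg, he⟩
  have hd : 0 < ‖a - b‖ := norm_pos_iff.2 (sub_ne_zero.2 hab)
  set r := ‖a - b‖ / 2 with hr
  have hr0 : 0 < r := half_pos hd
  have hab' : a - b ≠ 0 := sub_ne_zero.2 hab
  have hsub : ∀ θ, ‖circleMap a r θ - a‖ = r := fun θ => by
    rw [circleMap_sub_center, norm_circleMap_zero, abs_of_pos hr0]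
  have hmem : ∀ θ, circleMap a r θ ∈ ({a, b}ᶜ : Set ℂ) := by
    intro θ h
    have := hsub θ
    rcases h with h | h
    · rw [h] at this; simp at this; linarith
    · rw [mem_singleton_iff.1 h, norm_sub_rev] at this; linarith
  have hslit : ∀ θ, (circleMap a r θ - b) / (a - b) ∈ slitPlane := by
    intro θ
    have h1 : (circleMap a r θ - b) / (a - b) = 1 + (circleMap a r θ - a) / (a - b) := by
      field_simp; ring
    rw [h1]
    apply mem_slitPlane_of_norm_lt_one
    rw [norm_div, hsub, div_lt_one hd]
    linarith
  refine one_ne_zero (winding_eq_zero (m := 1) (c := r / (a - b))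
    (ℓ := fun θ => g (circleMap a r θ) + Complex.log ((circleMap a r θ - b) / (a - b))) ?_ ?_ ?_)
  · refine Continuous.add (hg.comp_continuous (continuous_circleMap a r) hmem) ?_
    exact Continuous.clog (by fun_prop) hslit
  · simp [circleMap]
  · intro θ
    have hb : circleMap a r θ - b ≠ 0 := sub_ne_zero.2 fun h => hmem θ (by simp [h])
    rw [exp_add, he _ (hmem θ), exp_log (slitPlane_ne_zero (hslit θ)), div_mul_div_cancel₀ hb,
      circleMap_sub_center]
    simp [circleMap]
    ring

/-- Two closed connected non-separating sets meeting in exactly two points have a union which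
separates the plane. -/
theorem not_isPreconnected_compl_union {A B : Set ℂ} (hA : IsClosed A) (hB : IsClosed B)
    (hAc : IsPreconnected A) (hBc : IsPreconnected B) (hA' : IsPreconnected Aᶜ)
    (hB' : IsPreconnected Bᶜ) {a b : ℂ} (hab : a ≠ b) (hAB : A ∩ B = {a, b}) :
    ¬ IsPreconnected (A ∪ B)ᶜ := by
  intro h
  have haAB : a ∈ A ∩ B := by rw [hAB]; simp
  have hbAB : b ∈ A ∩ B := by rw [hAB]; simp
  rw [compl_union] at h
  obtain ⟨g, hgA, hgB, he⟩ := (hasLogOn_compl hA hAc hA' haAB.1 hbAB.1).exists_common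
    (hasLogOn_compl hB hBc hB' haAB.2 hbAB.2) h
  apply not_hasLogOn_compl_pair hab
  rw [← hAB, compl_inter]
  exact ⟨g, hgA.union_of_isOpen hgB hA.isOpen_compl hB.isOpen_compl, he⟩

/-- If the complement of a compact set is not connected, it has a bounded component. -/
theorem exists_isBounded_connectedComponentIn {X : Set ℂ} (hX : IsCompact X)
    (h : ¬ IsPreconnected Xᶜ) :
    ∃ p ∉ X, Bornology.IsBounded (connectedComponentIn Xᶜ p) := by
  by_contra! hcon
  apply h
  obtain ⟨R, hR, hXR⟩ := hX.isBounded.exists_pos_norm_le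
  have hfar : ∀ p ∉ X, ∀ q, R < ‖q‖ → q ∈ connectedComponentIn Xᶜ p := fun p hp =>
    (isBounded_connectedComponentIn_or hR hXR p).resolve_left (hcon p hp)
  have h1 : R < ‖((R + 1 : ℝ) : ℂ)‖ := by
    rw [norm_real, Real.norm_of_nonneg (by positivity)]; linarith
  refine isPreconnected_of_forall_pair fun p hp q hq => ?_
  exact ⟨_, connectedComponentIn_subset _ _, mem_connectedComponentIn hp,
    connectedComponentIn_trans (hfar p hp _ h1) (connectedComponentIn_symm (hfar q hq _ h1)),
    isPreconnected_connectedComponentIn⟩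

/-- `ψ` is a `1`-periodic parametrization of the boundary curve of the Jordan domain `W`. -/
structure JordanParam (W : Set ℂ) (ψ : ℝ → ℂ) : Prop where
  isOpen : IsOpen W
  isConnected : IsConnected W
  isBounded : Bornology.IsBounded W
  continuous : Continuous ψ
  eq_iff : ∀ s t, ψ s = ψ t ↔ ∃ k : ℤ, t = s + k
  range_eq : range ψ = frontier W

theorem JordanDomain.exists_param {W : Set ℂ} (h : JordanDomain W) : ∃ ψ, JordanParam W ψ := by
  obtain ⟨hO, hc, hb, φ, hφ, hi, hr⟩ := h
  have hmem : ∀ t : ℝ, exp (2 * Real.pi * t * I) ∈ sphere (0 : ℂ) 1 := by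
    intro t
    have := norm_exp_ofReal_mul_I (2 * Real.pi * t)
    simpa using this
  refine ⟨fun t => φ ⟨exp (2 * Real.pi * t * I), hmem t⟩, hO, hc, hb, ?_, ?_, ?_⟩
  · exact hφ.comp (Continuous.subtype_mk (by fun_prop) _)
  · intro s t
    rw [hi.eq_iff, Subtype.mk.injEq, eq_comm, exp_eq_exp_iff_exists_int]
    have hpi : (2 * Real.pi * I : ℂ) ≠ 0 := by simp [Real.pi_ne_zero, I_ne_zero]
    refine exists_congr fun k => ?_
    rw [show (2 * Real.pi * t * I : ℂ) = t * (2 * Real.pi * I) by ring,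
      show (2 * Real.pi * s * I + k * (2 * Real.pi * I) : ℂ) = (s + k) * (2 * Real.pi * I) by ring,
      mul_left_inj' hpi]
    exact_mod_cast Iff.rfl
  · rw [← hr]
    apply Subset.antisymm
    · rintro _ ⟨t, rfl⟩
      exact ⟨_, rfl⟩
    · rintro _ ⟨⟨z, hz⟩, rfl⟩
      refine ⟨arg z / (2 * Real.pi), ?_⟩
      beta_reduce
      congr 2
      have hz1 : ‖z‖ = 1 := by simpa using hz
      have h2 := norm_mul_exp_arg_mul_I z
      rw [hz1, ofReal_one, one_mul] at h2
      have hpi : (2 * Real.pi : ℂ) ≠ 0 := by simp [Real.pi_ne_zero]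
      rw [ofReal_div, ofReal_mul, ofReal_ofNat, mul_div_cancel₀ _ hpi, h2]

/-- A connected set meeting `A` but not its frontier is contained in `A`. -/
theorem IsPreconnected.subset_of_disjoint_frontier {S A : Set ℂ} (hS : IsPreconnected S)
    (hne : (S ∩ A).Nonempty) (hd : ∀ x ∈ S, x ∉ frontier A) : S ⊆ A := by
  refine (hS.subset_left_of_subset_union isOpen_interior isClosed_closure.isOpen_compl
    (disjoint_compl_right.mono_left (interior_subset.trans subset_closure)) ?_ ?_).trans
    interior_subset
  · intro x hx
    by_cases hxc : x ∈ closure A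
    · exact Or.inl (by_contra fun h => hd x hx ⟨hxc, h⟩)
    · exact Or.inr hxc
  · obtain ⟨x, hx, hxA⟩ := hne
    exact ⟨x, hx, by_contra fun h => hd x hx ⟨subset_closure hxA, h⟩⟩

namespace JordanParam

variable {W : Set ℂ} {ψ : ℝ → ℂ}

theorem add_int (h : JordanParam W ψ) (t : ℝ) (k : ℤ) : ψ (t + k) = ψ t :=
  ((h.eq_iff t (t + k)).2 ⟨k, rfl⟩).symm

theorem injOn (h : JordanParam W ψ) {s t : ℝ} (hst : t < s + 1) : InjOn ψ (Icc s t) := by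
  intro x hx y hy hxy
  obtain ⟨k, rfl⟩ := (h.eq_iff _ _).1 hxy
  have h1 : (k : ℝ) < 1 := by linarith [hx.1, hx.2, hy.1, hy.2]
  have h2 : (-1 : ℝ) < k := by linarith [hx.1, hx.2, hy.1, hy.2]
  have h3 : k < 1 := by exact_mod_cast h1
  have h4 : -1 < k := by exact_mod_cast h2
  have : k = 0 := by lia
  simp [this]

theorem isCompact_frontier (h : JordanParam W ψ) : IsCompact (frontier W) :=
  isCompact_of_isClosed_isBounded isClosed_frontier
    (h.isBounded.closure.subset frontier_subset_closure)

theorem isCompact_closure (h : JordanParam W ψ) : IsCompact (closure W) :=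
  isCompact_of_isClosed_isBounded isClosed_closure h.isBounded.closure

theorem mem_frontier (h : JordanParam W ψ) (t : ℝ) : ψ t ∈ frontier W := by
  rw [← h.range_eq]; exact mem_range_self t

theorem exists_mem_Ico (h : JordanParam W ψ) {x : ℂ} (hx : x ∈ frontier W) (s : ℝ) :
    ∃ t ∈ Ico s (s + 1), ψ t = x := by
  rw [← h.range_eq] at hx
  obtain ⟨t, rfl⟩ := hx
  refine ⟨t + (-⌊t - s⌋ : ℤ), ?_, h.add_int _ _⟩
  push_cast
  constructor
  · linarith [Int.floor_le (t - s)]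
  · linarith [Int.lt_floor_add_one (t - s)]

theorem image_Icc_eq (h : JordanParam W ψ) (s : ℝ) : ψ '' Icc s (s + 1) = frontier W := by
  apply Subset.antisymm
  · rintro _ ⟨t, -, rfl⟩
    exact h.mem_frontier t
  · intro x hx
    obtain ⟨t, ht, rfl⟩ := h.exists_mem_Ico hx s
    exact ⟨t, Ico_subset_Icc_self ht, rfl⟩

theorem exists_lift (h : JordanParam W ψ) {p : ℂ} (hp : p ∉ frontier W) :
    ∃ ℓ : ℝ → ℂ, Continuous ℓ ∧ (∀ t, exp (ℓ t) = ψ t - p) ∧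
      ∃ k : ℤ, ℓ 1 - ℓ 0 = k * (2 * Real.pi * I) := by
  obtain ⟨ℓ, hℓ, he⟩ := exists_log_of_simplyConnected (f := fun t => ψ t - p)
    (by have := h.continuous; fun_prop)
    (fun t => by
      rw [sub_ne_zero]
      rintro rfl
      exact hp (h.mem_frontier t))
  refine ⟨ℓ, hℓ, he, ?_⟩
  have h1 : ψ 1 = ψ 0 := by simpa using h.add_int 0 1
  obtain ⟨k, hk⟩ := exp_eq_exp_iff_exists_int.1 (show exp (ℓ 1) = exp (ℓ 0) by rw [he, he, h1])
  exact ⟨k, by rw [hk]; ring⟩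

/-- A function with equal values at the ends of a period descends to the boundary curve. -/
theorem exists_descend (h : JordanParam W ψ) {g : ℝ → ℂ} (hg : Continuous g) (h01 : g 0 = g 1) :
    ∃ G : ℂ → ℂ, ContinuousOn G (frontier W) ∧ ∀ t ∈ Icc (0 : ℝ) 1, G (ψ t) = g t := by
  have := _root_.exists_descend (S := Icc (0 : ℝ) 1) (f := ψ) (g := g) isCompact_Icc
    h.continuous.continuousOn hg.continuousOn ?_
  · have hi := h.image_Icc_eq 0
    rw [zero_add] at hi
    rwa [hi] at this
  · intro s hs t ht hst
    obtain ⟨k, rfl⟩ := (h.eq_iff _ _).1 hst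
    have h1 : (k : ℝ) ≤ 1 := by linarith [hs.1, ht.2]
    have h2 : (-1 : ℝ) ≤ k := by linarith [hs.2, ht.1]
    have h3 : k ≤ 1 := by exact_mod_cast h1
    have h4 : -1 ≤ k := by exact_mod_cast h2
    obtain rfl | rfl | rfl : k = -1 ∨ k = 0 ∨ k = 1 := by lia
    · have : s = 1 := by push_cast at ht; linarith [hs.2, ht.1]
      subst this; simp [h01]
    · simp
    · have : s = 0 := by push_cast at ht; linarith [hs.1, ht.2]
      subst this; simp [h01]

/-- The exterior of a Jordan curve is connected. -/
theorem isPreconnected_compl (h : JordanParam W ψ) : IsPreconnected (closure W)ᶜ := by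
  by_contra hcon
  obtain ⟨q, hq, hqb⟩ := exists_isBounded_connectedComponentIn h.isCompact_closure hcon
  obtain ⟨p, hp⟩ := h.isConnected.nonempty
  have hpJ : p ∉ frontier W := fun hpf => by
    rw [h.isOpen.frontier_eq] at hpf; exact hpf.2 hp
  have hqJ : q ∉ frontier W := fun hqf => hq (frontier_subset_closure hqf)
  obtain ⟨f, hf, hfe, k, hk⟩ := h.exists_lift hpJ
  obtain ⟨g, hg, hge, m, hm⟩ := h.exists_lift hqJ
  have hpne : ∀ x ∈ frontier W, x - p ≠ 0 := fun x hx hxp => hpJ (by rwa [← sub_eq_zero.1 hxp])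
  have hm0 : m = 0 := by
    obtain ⟨G, hG, hGe⟩ := h.exists_descend (g := fun t => m * f t - k * g t) (by fun_prop) (by
      linear_combination (k : ℂ) * hm - (m : ℂ) * hk)
    refine exponent_eq_zero_of_log h.isOpen h.isBounded h.isCompact_frontier subset_rfl hp
      (f := fun x => (x - q) ^ k) (m := m) ?_ ?_ hG ?_
    · intro x hx
      refine ContinuousWithinAt.zpow₀ (by fun_prop) _ (Or.inl ?_)
      rw [sub_ne_zero]
      rintro rfl
      exact hq hx
    · intro x hx
      refine zpow_ne_zero _ ?_
      rw [sub_ne_zero]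
      rintro rfl
      exact hq (subset_closure hx)
    · intro x hx
      rw [← h.image_Icc_eq 0, zero_add] at hx
      obtain ⟨t, ht, rfl⟩ := hx
      rw [hGe t ht, exp_sub, exp_int_mul, exp_int_mul, hfe, hge, div_mul_cancel₀]
      refine zpow_ne_zero _ ?_
      rw [← hge]
      exact exp_ne_zero _
  obtain ⟨G, hG, hGe⟩ := h.exists_descend hg (by
    rw [hm0] at hm
    simp only [Int.cast_zero, zero_mul] at hm
    exact (sub_eq_zero.1 hm).symm)
  refine one_ne_zero (exponent_eq_zero_of_log (O := connectedComponentIn (closure W)ᶜ q)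
    (X := frontier W) isClosed_closure.isOpen_compl.connectedComponentIn hqb h.isCompact_frontier
    ?_ (mem_connectedComponentIn hq) (f := fun _ => 1) (m := 1) continuousOn_const (by simp) hG ?_)
  · intro x hx
    have h1 := frontier_connectedComponentIn_subset isClosed_closure.isOpen_compl q hx
    rw [compl_compl] at h1
    have h2 : x ∈ closure (closure W)ᶜ :=
      closure_mono (connectedComponentIn_subset _ _) (frontier_subset_closure hx)
    refine ⟨h1, fun h3 => ?_⟩
    rw [closure_compl] at h2
    exact h2 (interior_mono subset_closure h3)
  · intro x hx
    rw [← h.image_Icc_eq 0, zero_add] at hx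
    obtain ⟨t, ht, rfl⟩ := hx
    rw [hGe t ht, hge]
    simp

/-- Every point of a Jordan curve is a limit of exterior points. -/
theorem mem_closure_compl (h : JordanParam W ψ) (t : ℝ) : ψ t ∈ closure (closure W)ᶜ := by
  by_contra hcon
  rw [closure_compl, mem_compl_iff, not_not] at hcon
  have hU : ψ ⁻¹' interior (closure W) ∈ nhds t :=
    (h.continuous.continuousAt).preimage_mem_nhds (isOpen_interior.mem_nhds hcon)
  obtain ⟨η, hη, hball⟩ := Metric.mem_nhds_iff.1 hU
  set δ := min (η / 2) (1 / 4) with hδ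
  have hδ0 : 0 < δ := lt_min (half_pos hη) (by norm_num)
  have hδη : δ < η := (min_le_left _ _).trans_lt (half_lt_self hη)
  set L := ψ '' Icc (t + δ) (t + 1 - δ) with hL
  have hLc : IsPreconnected Lᶜ :=
    isPreconnected_compl_arc h.continuous.continuousOn (h.injOn (by linarith))
  have hsub : frontier (closure W) ⊆ L := by
    intro x hx
    obtain ⟨s, hs, rfl⟩ := h.exists_mem_Ico (frontier_closure_subset hx) (t - δ)
    rcases le_or_gt (t + δ) s with h1 | h1
    · exact ⟨s, ⟨h1, by linarith [hs.2]⟩, rfl⟩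
    · exfalso
      refine hx.2 (hball (mem_ball.2 ?_))
      rw [Real.dist_eq, abs_lt]
      constructor <;> linarith [hs.1]
  have hLJ : L ⊆ frontier W := by
    rintro _ ⟨s, -, rfl⟩
    exact h.mem_frontier s
  obtain ⟨p, hp⟩ := h.isConnected.nonempty
  obtain ⟨R, hR, hWR⟩ := h.isBounded.closure.exists_pos_norm_le
  have h1 : ((R + 1 : ℝ) : ℂ) ∉ closure W := fun hc => by
    have := hWR _ hc
    rw [norm_real, Real.norm_of_nonneg (by positivity)] at this
    linarith
  refine h1 (hLc.subset_of_disjoint_frontier (A := closure W) ⟨p, ?_, subset_closure hp⟩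
    (fun x hx hxf => hx (hsub hxf)) fun hc => h1 (frontier_subset_closure (hLJ hc)))
  intro hc
  have := hLJ hc
  rw [h.isOpen.frontier_eq] at this
  exact this.2 hp

end JordanParam

/-- The exterior of a Jordan curve is uniformly locally connected. -/
theorem JordanParam.exists_joined_near {W : Set ℂ} {ψ : ℝ → ℂ} (h : JordanParam W ψ) (t : ℝ)
    {ε : ℝ} (hε : 0 < ε) :
    ∃ δ > 0, δ ≤ ε ∧ ∀ p ∈ (closure W)ᶜ ∩ ball (ψ t) δ, ∀ q ∈ (closure W)ᶜ ∩ ball (ψ t) δ,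
      q ∈ connectedComponentIn ((closure W)ᶜ ∩ ball (ψ t) ε) p := by
  obtain ⟨η₀, hη₀, hball⟩ := Metric.continuous_iff.1 h.continuous t ε hε
  set η := min (η₀ / 2) (1 / 4) with hη
  have hη0 : 0 < η := lt_min (half_pos hη₀) (by norm_num)
  have hηη : η < η₀ := (min_le_left _ _).trans_lt (half_lt_self hη₀)
  have hη4 : η ≤ 1 / 4 := min_le_right _ _
  set L := ψ '' Icc (t + η) (t + 1 - η) with hL
  have hLk : IsCompact L := isCompact_Icc.image h.continuous
  have hLp : IsPreconnected L := isPreconnected_Icc.image _ h.continuous.continuousOn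
  have hLne : L.Nonempty := (nonempty_Icc.2 (by linarith)).image _
  have htL : ψ t ∉ L := by
    rintro ⟨s, hs, hst⟩
    obtain ⟨k, hk⟩ := (h.eq_iff t s).1 hst.symm
    rw [hk] at hs
    have h1 : (0 : ℝ) < k := by linarith [hs.1]
    have h2 : (k : ℝ) < 1 := by linarith [hs.2]
    have h3 : 0 < k := by exact_mod_cast h1
    have h4 : k < 1 := by exact_mod_cast h2
    lia
  have hLJ : L ⊆ frontier W := by
    rintro _ ⟨s, -, rfl⟩
    exact h.mem_frontier s
  have hpos : 0 < infDist (ψ t) L := (hLk.isClosed.notMem_iff_infDist_pos hLne).1 htL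
  have hAB : frontier W ∩ (sphere (ψ t) ε ∪ L) = L := by
    apply Subset.antisymm
    · rintro x ⟨hx, hx' | hx'⟩
      · obtain ⟨s, hs, rfl⟩ := h.exists_mem_Ico hx (t - η)
        refine ⟨s, ⟨?_, by linarith [hs.2]⟩, rfl⟩
        by_contra hlt
        have := hball s (by rw [Real.dist_eq, abs_lt]; constructor <;> linarith [hs.1])
        exact this.ne hx'
      · exact hx'
    · exact fun x hx => ⟨hLJ hx, Or.inr hx⟩
  refine ⟨min ε (infDist (ψ t) L), lt_min hε hpos, min_le_left _ _, ?_⟩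
  rintro p ⟨hpK, hp⟩ q ⟨hqK, hq⟩
  have hballB : ball (ψ t) (min ε (infDist (ψ t) L)) ⊆ (sphere (ψ t) ε ∪ L)ᶜ := by
    rintro x hx (hx' | hx')
    · exact ((mem_ball.1 hx).trans_le (min_le_left _ _)).ne hx'
    · exact ((mem_ball'.1 hx).trans_le (min_le_right _ _)).not_ge (infDist_le_dist_of_mem hx')
  have hKJ : (closure W)ᶜ ⊆ (frontier W)ᶜ := compl_subset_compl.2 frontier_subset_closure
  have hj := janiszewski h.isCompact_frontier ((isCompact_sphere (ψ t) ε).union hLk)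
    (by rw [hAB]; exact hLp)
    (h.isPreconnected_compl.subset_connectedComponentIn hpK hKJ hqK)
    (isPreconnected_ball.subset_connectedComponentIn hp hballB hq)
  set S := connectedComponentIn (frontier W ∪ (sphere (ψ t) ε ∪ L))ᶜ p with hS
  have hSp : IsPreconnected S := isPreconnected_connectedComponentIn
  have hSsub : S ⊆ (frontier W ∪ (sphere (ψ t) ε ∪ L))ᶜ := connectedComponentIn_subset _ _
  have hpS : p ∈ S := mem_connectedComponentIn (mem_of_mem_connectedComponentIn hj)
  refine hSp.subset_connectedComponentIn hpS (subset_inter ?_ ?_) hj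
  · refine hSp.subset_of_disjoint_frontier ⟨p, hpS, hpK⟩ fun x hx hxf => hSsub hx (Or.inl ?_)
    rw [frontier_compl] at hxf
    exact frontier_closure_subset hxf
  · refine hSp.subset_of_disjoint_frontier ⟨p, hpS, ?_⟩ fun x hx hxf =>
      hSsub hx (Or.inr (Or.inl (frontier_ball_subset_sphere hxf)))
    exact ball_subset_ball (min_le_left _ _) hp

/-- The points `a` and `b` are equal or joined by an arc in `S`. -/
def ArcJoined (S : Set ℂ) (a b : ℂ) : Prop :=
  ∃ (l : ℝ) (f : ℝ → ℂ), 0 ≤ l ∧ ContinuousOn f (Icc 0 l) ∧ InjOn f (Icc 0 l) ∧ f 0 = a ∧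
    f l = b ∧ ∀ t ∈ Icc 0 l, f t ∈ S

theorem ArcJoined.refl {S : Set ℂ} {a : ℂ} (ha : a ∈ S) : ArcJoined S a a :=
  ⟨0, fun _ => a, le_rfl, continuousOn_const, by simp, rfl, rfl, fun _ _ => ha⟩

/-- An arc can be continued along a segment. -/
theorem ArcJoined.append_segment {S : Set ℂ} {a x y : ℂ} (h : ArcJoined S a x)
    (hxy : segment ℝ x y ⊆ S) : ArcJoined S a y := by
  obtain ⟨l, f, hl, hf, hi, h0, h1, hS⟩ := h
  have hC : IsCompact (segment ℝ x y) := by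
    rw [segment_eq_image_lineMap]
    exact isCompact_Icc.image (AffineMap.lineMap_continuous)
  have hT : IsClosed (Icc 0 l ∩ f ⁻¹' segment ℝ x y) :=
    hf.preimage_isClosed_of_isClosed isClosed_Icc hC.isClosed
  obtain ⟨s, ⟨⟨hs0, hsl⟩, hsC⟩, hmin⟩ := (isCompact_Icc.of_isClosed_subset hT
    inter_subset_left).exists_isLeast ⟨l, right_mem_Icc.2 hl, by
      rw [mem_preimage, h1]; exact left_mem_segment ℝ x y⟩
  have hfirst : ∀ t, 0 ≤ t → t < s → f t ∉ segment ℝ x y := fun t ht hts hc =>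
    (hmin ⟨⟨ht, hts.le.trans hsl⟩, hc⟩).not_gt hts
  have hsub : Icc 0 s ⊆ Icc 0 l := Icc_subset_Icc_right hsl
  by_cases hz : f s = y
  · exact ⟨s, f, hs0, hf.mono hsub, hi.mono hsub, h0, hz, fun t ht => hS t (hsub ht)⟩
  set z := f s with hzdef
  have hz' : y - z ≠ 0 := sub_ne_zero.2 (Ne.symm hz)
  have hseg : segment ℝ z y ⊆ segment ℝ x y :=
    (convex_segment x y).segment_subset hsC (right_mem_segment ℝ x y)
  set g : ℝ → ℂ := fun t => f (min t s) + ((max (t - s) 0 : ℝ) : ℂ) * (y - z) with hg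
  have hg1 : ∀ t, t ≤ s → g t = f t := fun t ht => by
    simp [hg, min_eq_left ht, max_eq_right (sub_nonpos.2 ht)]
  have hg2 : ∀ t, s ≤ t → g t = z + ((t - s : ℝ) : ℂ) * (y - z) := fun t ht => by
    simp only [hg, min_eq_right ht, max_eq_left (sub_nonneg.2 ht), hzdef]
  have hgseg : ∀ t, s ≤ t → t ≤ s + 1 → g t ∈ segment ℝ z y := by
    intro t h1 h2
    rw [segment_eq_image', hg2 t h1]
    exact ⟨t - s, ⟨by linarith, by linarith⟩, by simp⟩
  refine ⟨s + 1, g, by linarith, ?_, ?_, by rw [hg1 0 hs0, h0], ?_, ?_⟩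
  · refine ContinuousOn.add ?_ (by fun_prop)
    refine hf.comp (by fun_prop) ?_
    intro t ht
    exact ⟨le_min ht.1 hs0, (min_le_right _ _).trans hsl⟩
  · have key : ∀ t ∈ Icc 0 (s + 1), ∀ t' ∈ Icc 0 (s + 1), t ≤ t' → g t = g t' → t = t' := by
      intro t ht t' ht' htt hgt
      rcases le_or_gt t' s with hc | hc
      · rw [hg1 t (htt.trans hc), hg1 t' hc] at hgt
        exact hi (hsub ⟨ht.1, htt.trans hc⟩) (hsub ⟨ht'.1, hc⟩) hgt
      rcases lt_or_ge t s with hc' | hc'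
      · exfalso
        refine hfirst t ht.1 hc' (hseg ?_)
        rw [← hg1 t hc'.le, hgt]
        exact hgseg t' hc.le ht'.2
      · rw [hg2 t hc', hg2 t' hc.le, add_right_inj, mul_left_inj' hz', ofReal_inj] at hgt
        linarith
    intro t ht t' ht' hgt
    rcases le_total t t' with hc | hc
    · exact key t ht t' ht' hc hgt
    · exact (key t' ht' t ht hc hgt.symm).symm
  · rw [hg2 _ (by linarith)]; simp
  · intro t ht
    rcases le_total t s with hc | hc
    · rw [hg1 t hc]; exact hS t (hsub ⟨ht.1, hc⟩)
    · exact hxy (hseg (hgseg t hc ht.2))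

/-- Two distinct points accessible by segments from a connected open set are joined by an arc
through this set. -/
theorem exists_arc {V : Set ℂ} (hV : IsOpen V) (hVc : IsPreconnected V) {a b u v : ℂ}
    (hab : a ≠ b) (hu : u ∈ V) (hv : v ∈ V) (hua : segment ℝ u a ⊆ insert a V)
    (hvb : segment ℝ v b ⊆ insert b V) :
    ∃ f : ℝ → ℂ, ContinuousOn f (Icc 0 1) ∧ InjOn f (Icc 0 1) ∧ f 0 = a ∧ f 1 = b ∧
      ∀ t ∈ Ioo (0 : ℝ) 1, f t ∈ V := by
  set S := insert a (insert b V) with hS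
  have hVS : V ⊆ S := (subset_insert _ _).trans (subset_insert _ _)
  have h1 : ArcJoined S a u := by
    refine (ArcJoined.refl (mem_insert a _)).append_segment ?_
    rw [segment_symm]
    exact hua.trans (insert_subset_insert (subset_insert _ _))
  have h2 : ArcJoined S a u → ArcJoined S a v := by
    refine hVc.induction₂' (fun x y => ArcJoined S a x → ArcJoined S a y) ?_ ?_ hu hv
    · intro x hx
      obtain ⟨ε, hε, hball⟩ := Metric.isOpen_iff.1 hV x hx
      filter_upwards [mem_nhdsWithin_of_mem_nhds (ball_mem_nhds x hε)] with y hy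
      have hseg := (convex_ball x ε).segment_subset (mem_ball_self hε) hy
      refine ⟨fun h => h.append_segment (hseg.trans (hball.trans hVS)), fun h => ?_⟩
      rw [segment_symm] at hseg
      exact h.append_segment (hseg.trans (hball.trans hVS))
    · exact fun x y z _ _ _ hxy hyz hx => hyz (hxy hx)
  obtain ⟨l, f, hl, hf, hi, h0, hl1, hfS⟩ := (h2 h1).append_segment (hvb.trans (subset_insert _ _))
  have hl0 : 0 < l := by
    refine hl.lt_of_ne ?_
    rintro rfl
    exact hab (h0.symm.trans hl1)
  have hmap : MapsTo (fun t => l * t) (Icc 0 1) (Icc 0 l) := fun t ht =>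
    ⟨mul_nonneg hl ht.1, mul_le_of_le_one_right hl ht.2⟩
  refine ⟨fun t => f (l * t), hf.comp (by fun_prop) hmap, ?_, by simp [h0], by simp [hl1], ?_⟩
  · intro t ht t' ht' htt
    exact mul_left_cancel₀ hl0.ne' (hi (hmap ht) (hmap ht') htt)
  · intro t ht
    have htl := hmap (Ioo_subset_Icc_self ht)
    rcases hfS _ htl with h | h | h
    · have := hi htl (left_mem_Icc.2 hl) (h.trans h0.symm)
      exact absurd this (mul_pos hl0 ht.1).ne'
    · have := hi htl (right_mem_Icc.2 hl) (h.trans hl1.symm)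
      have h3 : l * t < l := mul_lt_of_lt_one_right hl0 ht.2
      exact absurd this h3.ne
    · exact h

theorem mem_connectedComponentIn_of_norm_gt {X : Set ℂ} {R : ℝ} (hR : 0 < R)
    (hX : ∀ x ∈ X, ‖x‖ ≤ R) {q z : ℂ} (hq : R < ‖q‖) (hz : R < ‖z‖) :
    z ∈ connectedComponentIn Xᶜ q :=
  (isPreconnected_norm_gt hR).subset_connectedComponentIn hq (fun x hx hxX => (hX x hxX).not_gt hx)
    hz

namespace JordanParam

variable {W : Set ℂ} {ψ : ℝ → ℂ}

/-- Points of the Jordan curve near `ψ t` have a parameter near `t`. -/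
theorem exists_param_near (h : JordanParam W ψ) (t : ℝ) {ρ : ℝ} (hρ : 0 < ρ) :
    ∃ d > 0, ∀ x ∈ frontier W, dist x (ψ t) < d → ∃ s, |s - t| ≤ ρ ∧ ψ s = x := by
  wlog hρ4 : ρ ≤ 1 / 4 generalizing ρ
  · obtain ⟨d, hd, H⟩ := this (ρ := 1 / 4) (by norm_num) le_rfl
    refine ⟨d, hd, fun x hx hxd => ?_⟩
    obtain ⟨s, hs, hsx⟩ := H x hx hxd
    exact ⟨s, hs.trans (not_le.1 hρ4).le, hsx⟩
  set L := ψ '' Icc (t + ρ) (t + 1 - ρ) with hL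
  have hLk : IsCompact L := isCompact_Icc.image h.continuous
  have hLne : L.Nonempty := (nonempty_Icc.2 (by linarith)).image _
  have htL : ψ t ∉ L := by
    rintro ⟨s, hs, hst⟩
    obtain ⟨k, hk⟩ := (h.eq_iff t s).1 hst.symm
    rw [hk] at hs
    have h1 : (0 : ℝ) < k := by linarith [hs.1]
    have h2 : (k : ℝ) < 1 := by linarith [hs.2]
    have h3 : 0 < k := by exact_mod_cast h1
    have h4 : k < 1 := by exact_mod_cast h2
    lia
  refine ⟨infDist (ψ t) L, (hLk.isClosed.notMem_iff_infDist_pos hLne).1 htL, fun x hx hxd => ?_⟩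
  obtain ⟨s, hs, rfl⟩ := h.exists_mem_Ico hx (t - ρ)
  refine ⟨s, ?_, rfl⟩
  rw [abs_le]
  refine ⟨by linarith [hs.1], ?_⟩
  by_contra! hlt
  refine (infDist_le_dist_of_mem (x := ψ t) (s := L) (y := ψ s) ?_).not_gt (by rwa [dist_comm])
  exact ⟨s, ⟨by linarith, by linarith [hs.2]⟩, rfl⟩

/-- If a component `V` of the complement of `closure W ∪ Γ` clusters at a point of an open boundary
arc disjoint from `Γ`, then it contains the exterior points near each point of this arc. -/
theorem exterior_subset_component (h : JordanParam W ψ) {Γ : Set ℂ} (hΓ : IsCompact Γ) {g : ℂ}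
    {x y t₀ : ℝ} (hfree : ∀ t ∈ Ioo x y, ψ t ∉ Γ) (ht₀ : t₀ ∈ Ioo x y)
    (ht₀V : ψ t₀ ∈ closure (connectedComponentIn (closure W ∪ Γ)ᶜ g)) {t : ℝ} (ht : t ∈ Ioo x y) :
    ∃ δ > 0, (closure W)ᶜ ∩ ball (ψ t) δ ⊆ connectedComponentIn (closure W ∪ Γ)ᶜ g := by
  set V := connectedComponentIn (closure W ∪ Γ)ᶜ g with hV
  have hVsub : V ⊆ (closure W ∪ Γ)ᶜ := connectedComponentIn_subset _ _
  have hcase : ∀ t ∈ Ioo x y, ∃ δ > 0, (closure W)ᶜ ∩ ball (ψ t) δ ⊆ V ∨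
      ∀ z ∈ (closure W)ᶜ ∩ ball (ψ t) δ, z ∉ V := by
    intro t ht
    obtain ⟨ε, hε, hball⟩ := Metric.isOpen_iff.1 hΓ.isClosed.isOpen_compl _ (hfree t ht)
    obtain ⟨δ, hδ, -, hjoin⟩ := h.exists_joined_near t hε
    refine ⟨δ, hδ, ?_⟩
    by_contra! hcon
    obtain ⟨hn, z, hz, hzV⟩ := hcon
    refine hn fun w hw => ?_
    have h1 := hjoin z hz w hw
    have h2 : (closure W)ᶜ ∩ ball (ψ t) ε ⊆ (closure W ∪ Γ)ᶜ := by
      rw [compl_union]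
      exact inter_subset_inter_right _ hball
    exact connectedComponentIn_trans hzV (connectedComponentIn_mono _ h2 h1)
  have hne : ∀ t, ∀ δ > 0, ((closure W)ᶜ ∩ ball (ψ t) δ).Nonempty := by
    intro t δ hδ
    rw [inter_comm]
    exact mem_closure_iff.1 (h.mem_closure_compl t) _ isOpen_ball (mem_ball_self hδ)
  have hnear : ∀ t, ∀ δ > 0, ∀ᶠ s in nhds t, ∃ δ' > 0, ball (ψ s) δ' ⊆ ball (ψ t) δ := by
    intro t δ hδ
    filter_upwards [h.continuous.continuousAt.preimage_mem_nhds (ball_mem_nhds (ψ t) hδ)]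
      with s hs
    exact Metric.isOpen_iff.1 isOpen_ball _ hs
  have hstep : ∀ s ∈ Ioo x y, ∀ t ∈ Ioo x y,
      (∃ δ > 0, (closure W)ᶜ ∩ ball (ψ s) δ ⊆ V) → ∃ δ > 0, (closure W)ᶜ ∩ ball (ψ t) δ ⊆ V := by
    intro s hs t ht
    refine isPreconnected_Ioo.induction₂' (fun s t => (∃ δ > 0, (closure W)ᶜ ∩ ball (ψ s) δ ⊆ V) →
      ∃ δ > 0, (closure W)ᶜ ∩ ball (ψ t) δ ⊆ V) ?_ ?_ hs ht
    · intro t ht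
      obtain ⟨δ, hδ, hd⟩ := hcase t ht
      filter_upwards [mem_nhdsWithin_of_mem_nhds (hnear t δ hδ)] with s ⟨δ', hδ', hsub⟩
      rcases hd with hd | hd
      · exact ⟨fun _ => ⟨δ', hδ', (inter_subset_inter_right _ hsub).trans hd⟩,
          fun _ => ⟨δ, hδ, hd⟩⟩
      · refine ⟨?_, ?_⟩
        · rintro ⟨δ₁, hδ₁, h₁⟩
          obtain ⟨z, hz, hzb⟩ := hne t (min δ δ₁) (lt_min hδ hδ₁)
          exact absurd (h₁ ⟨hz, ball_subset_ball (min_le_right _ _) hzb⟩)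
            (hd z ⟨hz, ball_subset_ball (min_le_left _ _) hzb⟩)
        · rintro ⟨δ₁, hδ₁, h₁⟩
          obtain ⟨z, hz, hzb⟩ := hne s (min δ' δ₁) (lt_min hδ' hδ₁)
          exact absurd (h₁ ⟨hz, ball_subset_ball (min_le_right _ _) hzb⟩)
            (hd z ⟨hz, hsub (ball_subset_ball (min_le_left _ _) hzb)⟩)
    · exact fun _ _ _ _ _ _ h1 h2 h3 => h2 (h1 h3)
  refine hstep t₀ ht₀ t ht ?_
  obtain ⟨δ, hδ, hd⟩ := hcase t₀ ht₀
  refine ⟨δ, hδ, hd.resolve_right fun hd => ?_⟩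
  obtain ⟨z, hzb, hzV⟩ := mem_closure_iff.1 ht₀V _ isOpen_ball (mem_ball_self hδ)
  exact hd z ⟨fun hzW => hVsub hzV (Or.inl hzW), hzb⟩ hzV

/-- Points of the Jordan curve accessible by segments are dense. -/
theorem exists_accessible (h : JordanParam W ψ) {V : Set ℂ} {t δ : ℝ} (hδ : 0 < δ)
    (hV : (closure W)ᶜ ∩ ball (ψ t) δ ⊆ V) {ρ : ℝ} (hρ : 0 < ρ) :
    ∃ s, |s - t| ≤ ρ ∧ ∃ u ∈ V, segment ℝ u (ψ s) ⊆ insert (ψ s) V := by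
  obtain ⟨d, hd, hnear⟩ := h.exists_param_near t hρ
  have hm : 0 < min δ d / 2 := half_pos (lt_min hδ hd)
  obtain ⟨u, hub, huK⟩ := mem_closure_iff.1 (h.mem_closure_compl t) _ isOpen_ball
    (mem_ball_self hm)
  have hKt : ψ t ∈ closure W := frontier_subset_closure (h.mem_frontier t)
  obtain ⟨e, heK, he⟩ := h.isCompact_closure.exists_infDist_eq_dist ⟨_, hKt⟩ u
  have hue : dist u e < min δ d / 2 :=
    he ▸ (infDist_le_dist_of_mem hKt).trans_lt (mem_ball.1 hub)
  have heb : dist e (ψ t) < min δ d := by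
    have h1 := dist_triangle e u (ψ t)
    rw [dist_comm e u] at h1
    have h2 := mem_ball.1 hub
    linarith
  have hne : u ≠ e := fun hc => huK (hc ▸ heK)
  have hout : ∀ z ∈ ball u (dist u e), z ∉ closure W := by
    intro z hz hzK
    have := infDist_le_dist_of_mem (x := u) hzK
    rw [he] at this
    exact this.not_gt (mem_ball'.1 hz)
  have heJ : e ∈ frontier W := by
    rw [h.isOpen.frontier_eq]
    refine ⟨heK, fun heW => ?_⟩
    have h1 : e ∈ closure (ball u (dist u e)) := by
      rw [closure_ball u (dist_pos.2 hne).ne', mem_closedBall, dist_comm]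
    obtain ⟨z, hzW, hzb⟩ := mem_closure_iff.1 h1 W h.isOpen heW
    exact hout z hzb (subset_closure hzW)
  obtain ⟨s, hs, rfl⟩ := hnear e heJ (heb.trans_le (min_le_right _ _))
  refine ⟨s, hs, u, hV ⟨huK, ?_⟩, fun z hz => ?_⟩
  · exact ball_subset_ball ((half_le_self (lt_min hδ hd).le).trans (min_le_left _ _)) hub
  by_cases hzs : z = ψ s
  · exact Or.inl hzs
  right
  refine hV ⟨hout z ?_, ?_⟩
  · have h1 := dist_add_dist_of_mem_segment hz
    rw [mem_ball']
    have h2 := dist_pos.2 hzs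
    linarith
  · refine (convex_ball (ψ t) δ).segment_subset ?_ ?_ hz
    · exact ball_subset_ball ((half_le_self (lt_min hδ hd).le).trans (min_le_left _ _)) hub
    · exact heb.trans_le (min_le_left _ _)

/-- A cross-cut inside a bounded component `V` of the complement of `closure W ∪ Γ`, whose
endpoints cut off a boundary arc disjoint from `Γ`, has its region inside `V`. -/
theorem crossCutRegion_subset (h : JordanParam W ψ) {Γ : Set ℂ} (hΓ : IsCompact Γ)
    (hΓc : IsPreconnected Γ) {g : ℂ}
    (hb : Bornology.IsBounded (connectedComponentIn (closure W ∪ Γ)ᶜ g))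
    {x y s t : ℝ} (hxs : x < s) (hst : s ≤ t) (hty : t < y) (hyx : y < x + 1)
    (hfree : ∀ t ∈ Ioo x y, ψ t ∉ Γ) (hx : ψ x ∈ Γ) {f : ℝ → ℂ} (hf : ContinuousOn f (Icc 0 1))
    (hf0 : f 0 = ψ s) (hf1 : f 1 = ψ t)
    (hfV : ∀ r ∈ Ioo (0 : ℝ) 1, f r ∈ connectedComponentIn (closure W ∪ Γ)ᶜ g) :
    CrossCutRegion (closure W) f ⊆ connectedComponentIn (closure W ∪ Γ)ᶜ g := by
  set V := connectedComponentIn (closure W ∪ Γ)ᶜ g with hV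
  have hKk := h.isCompact_closure
  have hXk : IsCompact (closure W ∪ Γ) := hKk.union hΓ
  have hVo : IsOpen V := hXk.isClosed.isOpen_compl.connectedComponentIn
  have hVsub : V ⊆ (closure W ∪ Γ)ᶜ := connectedComponentIn_subset _ _
  set F := f '' Icc 0 1 with hF
  set D := ψ '' Icc s t with hD
  have hFk : IsCompact F := isCompact_Icc.image_of_continuousOn hf
  have hDk : IsCompact D := isCompact_Icc.image h.continuous
  have hDp : IsPreconnected D := isPreconnected_Icc.image _ h.continuous.continuousOn
  have hDc : IsPreconnected Dᶜ :=
    isPreconnected_compl_arc h.continuous.continuousOn (h.injOn (by linarith))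
  have hCk : IsCompact (F ∪ D) := hFk.union hDk
  have hDJ : D ⊆ frontier W := by
    rintro _ ⟨r, -, rfl⟩
    exact h.mem_frontier r
  have hDK : D ⊆ closure W := hDJ.trans frontier_subset_closure
  have hFVD : F ⊆ V ∪ D := by
    rintro _ ⟨r, hr, rfl⟩
    rcases hr.1.eq_or_lt with rfl | h0
    · exact Or.inr ⟨s, left_mem_Icc.2 hst, hf0.symm⟩
    rcases hr.2.eq_or_lt with rfl | h1
    · exact Or.inr ⟨t, right_mem_Icc.2 hst, hf1.symm⟩
    · exact Or.inl (hfV r ⟨h0, h1⟩)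
  have hCVD : F ∪ D ⊆ V ∪ D := union_subset hFVD subset_union_right
  have hDΓ : ∀ z ∈ D, z ∉ Γ := by
    rintro _ ⟨r, hr, rfl⟩
    exact hfree r ⟨by linarith [hr.1], by linarith [hr.2]⟩
  have hxD : ψ x ∉ D := by
    rintro ⟨r, hr, hrx⟩
    have := h.injOn hyx (x₁ := r) ⟨by linarith [hr.1], by linarith [hr.2]⟩
      (left_mem_Icc.2 (by linarith)) hrx
    linarith [hr.1]
  have hWD : W ⊆ closure W \ D := fun z hz => ⟨subset_closure hz, fun hzD => by
    have := hDJ hzD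
    rw [h.isOpen.frontier_eq] at this
    exact this.2 hz⟩
  set Z := (closure W \ D) ∪ Γ with hZ
  have hZp : IsPreconnected Z :=
    IsPreconnected.union (ψ x) ⟨frontier_subset_closure (h.mem_frontier x), hxD⟩ hx
      (h.isConnected.isPreconnected.subset_closure hWD sdiff_subset) hΓc
  have hZC : Z ⊆ (F ∪ D)ᶜ := by
    intro z hz hzC
    rcases hCVD hzC with hzV | hzD
    · exact hVsub hzV (hz.imp (fun hz => hz.1) id)
    · exact hz.elim (fun hz => hz.2 hzD) (hDΓ z hzD)
  obtain ⟨p, hp⟩ := h.isConnected.nonempty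
  have hpZ : p ∈ Z := Or.inl (hWD hp)
  have hpD : p ∉ D := (hWD hp).2
  have hZcomp : Z ⊆ connectedComponentIn (F ∪ D)ᶜ p := hZp.subset_connectedComponentIn hpZ hZC
  obtain ⟨R, hR, hYR⟩ := (hXk.union hCk).isBounded.exists_pos_norm_le
  obtain ⟨q, hqR⟩ : ∃ q : ℂ, R < ‖q‖ := ⟨((R + 1 : ℝ) : ℂ), by
    rw [norm_real, Real.norm_of_nonneg (by positivity)]; linarith⟩
  have hqX : q ∉ closure W ∪ Γ := fun hq => (hYR q (Or.inl hq)).not_gt hqR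
  have hKX : ∀ X ⊆ closure W ∪ Γ ∪ (F ∪ D), ∀ z ∈ X, ‖z‖ ≤ R := fun X hX z hz => hYR z (hX hz)
  have hpb : ¬ Bornology.IsBounded (connectedComponentIn (F ∪ D)ᶜ p) := by
    intro hpb
    set O := connectedComponentIn (closure W ∪ Γ)ᶜ q with hO
    have hqO : q ∈ O := mem_connectedComponentIn hqX
    have hOV : ∀ z ∈ O, z ∉ V := by
      intro z hzO hzV
      have hqV : q ∈ V := connectedComponentIn_trans hzV (connectedComponentIn_symm hzO)
      exact not_isBounded_of_forall_norm_gt (fun z hz => connectedComponentIn_trans hqV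
        (mem_connectedComponentIn_of_norm_gt hR (hKX _ subset_union_left) hqR hz)) hb
    have hOC : O ⊆ (F ∪ D)ᶜ := fun z hz hzC => (hCVD hzC).elim (hOV z hz) fun hzD =>
      connectedComponentIn_subset _ _ hz (Or.inl (hDK hzD))
    have hOsub : O ⊆ connectedComponentIn (F ∪ D)ᶜ q :=
      isPreconnected_connectedComponentIn.subset_connectedComponentIn hqO hOC
    have hOp : ∀ z ∈ O, z ∉ connectedComponentIn (F ∪ D)ᶜ p := by
      intro z hz hzp
      have hqp : q ∈ connectedComponentIn (F ∪ D)ᶜ p :=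
        connectedComponentIn_trans hzp (connectedComponentIn_symm (hOsub hz))
      exact not_isBounded_of_forall_norm_gt (fun z hz => connectedComponentIn_trans hqp
        (mem_connectedComponentIn_of_norm_gt hR (hKX _ subset_union_right) hqR hz)) hpb
    have hpO : p ∈ O := by
      refine hDc.subset_of_disjoint_frontier (A := O) ⟨q, fun hqD => hqX (Or.inl (hDK hqD)), hqO⟩
        (fun z hzD hzf => ?_) hpD
      have h1 := frontier_connectedComponentIn_subset hXk.isClosed.isOpen_compl q hzf
      rw [compl_compl] at h1
      have h2 : z ∈ Z := h1.imp (fun h => ⟨h, hzD⟩) id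
      obtain ⟨w, hwp, hwO⟩ := mem_closure_iff.1 (frontier_subset_closure hzf) _
        hCk.isClosed.isOpen_compl.connectedComponentIn (hZcomp h2)
      exact hOp w hwO hwp
    exact connectedComponentIn_subset _ _ hpO (Or.inl (subset_closure hp))
  rintro w ⟨hwX, hwb⟩
  have hKFC : closure W ∪ (F ∪ D) = closure W ∪ F := by
    rw [union_left_comm, union_eq_left.2 hDK, union_comm]
  have hwC : w ∉ F ∪ D := fun hc => hwX (hKFC ▸ Or.inr hc)
  set H := connectedComponentIn (F ∪ D)ᶜ w with hH
  have hwH : w ∈ H := mem_connectedComponentIn hwC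
  have hHo : IsOpen H := hCk.isClosed.isOpen_compl.connectedComponentIn
  have hHp : IsPreconnected H := isPreconnected_connectedComponentIn
  have hHb : Bornology.IsBounded H := by
    refine (isBounded_connectedComponentIn_or hR (hKX _ subset_union_right) w).resolve_right
      fun hfar => ?_
    have hKC : closure W ∩ (F ∪ D) = D := by
      refine Subset.antisymm ?_ fun z hz => ⟨hDK hz, Or.inr hz⟩
      rintro z ⟨hzK, hzC⟩
      exact (hCVD hzC).resolve_left fun hzV => hVsub hzV (Or.inl hzK)
    have hj : q ∈ connectedComponentIn (closure W ∪ (F ∪ D))ᶜ w := by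
      refine janiszewski hKk hCk (by rwa [hKC]) ?_ (hfar q hqR)
      exact h.isPreconnected_compl.subset_connectedComponentIn (fun hc => hwX (Or.inl hc))
        subset_rfl (fun hc => hqX (Or.inl hc))
    rw [hKFC] at hj
    refine not_isBounded_of_forall_norm_gt (fun z hz => connectedComponentIn_trans hj
      (mem_connectedComponentIn_of_norm_gt hR (hKX _ ?_) hqR hz)) hwb
    exact union_subset (subset_union_left.trans subset_union_left)
      (subset_union_left.trans subset_union_right)
  have hpH : p ∉ H := fun hpH => hpb (by rwa [← connectedComponentIn_eq hpH])
  have hHX : H ⊆ (closure W ∪ Γ)ᶜ := by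
    intro z hzH hzX
    by_cases hzD : z ∈ D
    · exact connectedComponentIn_subset _ _ hzH (Or.inr hzD)
    · have hzp := hZcomp (hzX.imp (fun hz => ⟨hz, hzD⟩) id : z ∈ Z)
      exact hpH (connectedComponentIn_trans hzH (connectedComponentIn_symm hzp))
  obtain ⟨z, hzf, hzD⟩ : ∃ z ∈ frontier H, z ∉ D := by
    by_contra! hcon
    exact hpH (hDc.subset_of_disjoint_frontier (A := H) ⟨w, fun hc => hwC (Or.inr hc), hwH⟩
      (fun z hzD hzf => hzD (hcon z hzf)) hpD)
  have hzC := frontier_connectedComponentIn_subset hCk.isClosed.isOpen_compl w hzf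
  rw [compl_compl] at hzC
  have hzV := (hCVD hzC).resolve_right hzD
  obtain ⟨z', hz'V, hz'H⟩ := mem_closure_iff.1 (frontier_subset_closure hzf) _ hVo hzV
  have h1 := hHp.subset_connectedComponentIn hz'H hHX hwH
  exact connectedComponentIn_trans hz'V h1

/-- The region of a cross-cut of the exterior of a Jordan curve is nonempty. -/
theorem crossCutRegion_nonempty (h : JordanParam W ψ) {f : ℝ → ℂ}
    (hf : CrossCut (closure W) f) : (CrossCutRegion (closure W) f).Nonempty := by
  have hKF := hf.inter_image
  obtain ⟨hfc, hfi, -, -, h01, -⟩ := hf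
  have hFk : IsCompact (f '' Icc 0 1) := isCompact_Icc.image_of_continuousOn hfc
  obtain ⟨p, hp, hpb⟩ := exists_isBounded_connectedComponentIn (h.isCompact_closure.union hFk)
    (not_isPreconnected_compl_union isClosed_closure hFk.isClosed
      h.isConnected.isPreconnected.closure (isPreconnected_Icc.image _ hfc)
      h.isPreconnected_compl (isPreconnected_compl_arc hfc hfi) h01 hKF)
  exact ⟨p, hp, hpb⟩

/-- A bounded component of the complement of `closure W ∪ Γ` clustering at a point of a boundary
arc contains the nonempty region of a cross-cut whose endpoints are close to those of the arc. -/
theorem exists_crossCut (h : JordanParam W ψ) {Γ : Set ℂ} (hΓ : IsCompact Γ)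
    (hΓc : IsPreconnected Γ) {g : ℂ}
    (hb : Bornology.IsBounded (connectedComponentIn (closure W ∪ Γ)ᶜ g))
    {x y t₀ : ℝ} (hyx : y < x + 1) (hfree : ∀ t ∈ Ioo x y, ψ t ∉ Γ) (hx : ψ x ∈ Γ)
    (ht₀ : t₀ ∈ Ioo x y) (ht₀V : ψ t₀ ∈ closure (connectedComponentIn (closure W ∪ Γ)ᶜ g))
    {η : ℝ} (hη : 0 < η) :
    ∃ f, CrossCut (closure W) f ∧ dist (f 0) (ψ x) < η ∧ dist (f 1) (ψ y) < η ∧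
      CrossCutRegion (closure W) f ⊆ connectedComponentIn (closure W ∪ Γ)ᶜ g := by
  obtain ⟨ρ₁, hρ₁, hx₁⟩ := Metric.continuous_iff.1 h.continuous x η hη
  obtain ⟨ρ₂, hρ₂, hy₂⟩ := Metric.continuous_iff.1 h.continuous y η hη
  have hxy : x < y := ht₀.1.trans ht₀.2
  obtain ⟨ρ, hρ, h1, h2, h3⟩ : ∃ ρ > 0, 2 * ρ ≤ ρ₁ ∧ 2 * ρ ≤ ρ₂ ∧ 4 * ρ ≤ y - x := by
    refine ⟨min (min ρ₁ ρ₂ / 2) ((y - x) / 4),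
      lt_min (half_pos (lt_min hρ₁ hρ₂)) (by linarith), ?_, ?_, ?_⟩
    · linarith [min_le_left (min ρ₁ ρ₂ / 2) ((y - x) / 4), min_le_left ρ₁ ρ₂]
    · linarith [min_le_left (min ρ₁ ρ₂ / 2) ((y - x) / 4), min_le_right ρ₁ ρ₂]
    · linarith [min_le_right (min ρ₁ ρ₂ / 2) ((y - x) / 4)]
  obtain ⟨δ, hδ, hδV⟩ := h.exterior_subset_component hΓ hfree ht₀ ht₀V (t := x + ρ)
    ⟨by linarith, by linarith⟩
  obtain ⟨δ', hδ', hδV'⟩ := h.exterior_subset_component hΓ hfree ht₀ ht₀V (t := y - ρ)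
    ⟨by linarith, by linarith⟩
  obtain ⟨s, hs, u, hu, hus⟩ := h.exists_accessible hδ hδV (half_pos hρ)
  obtain ⟨t, ht, v, hv, hvt⟩ := h.exists_accessible hδ' hδV' (half_pos hρ)
  rw [abs_le] at hs ht
  have hst : ψ s ≠ ψ t := fun hc => by
    have := h.injOn hyx (x₁ := s) (x₂ := t) ⟨by linarith, by linarith⟩
      ⟨by linarith, by linarith⟩ hc
    linarith
  obtain ⟨f, hf, hi, hf0, hf1, hfV⟩ := exists_arc
    (h.isCompact_closure.union hΓ).isClosed.isOpen_compl.connectedComponentIn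
    isPreconnected_connectedComponentIn hst hu hv hus hvt
  refine ⟨f, ⟨hf, hi, ?_, ?_, ?_, fun r hr hrK => ?_⟩, ?_, ?_, ?_⟩
  · rw [hf0]; exact frontier_subset_closure (h.mem_frontier s)
  · rw [hf1]; exact frontier_subset_closure (h.mem_frontier t)
  · rwa [hf0, hf1]
  · exact connectedComponentIn_subset _ _ (hfV r hr) (Or.inl hrK)
  · rw [hf0]
    exact hx₁ s (by rw [Real.dist_eq, abs_lt]; constructor <;> linarith)
  · rw [hf1]
    exact hy₂ t (by rw [Real.dist_eq, abs_lt]; constructor <;> linarith)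
  · exact h.crossCutRegion_subset hΓ hΓc hb (x := x) (y := y) (s := s) (t := t) (by linarith)
      (by linarith) (by linarith) hyx hfree hx hf hf0 hf1 hfV

end JordanParam

/-- The parameters lying between two parameters of `P` which are not separated by `Q`. -/
def hullAvoiding (P Q : Set ℝ) : Set ℝ :=
  {t | ∃ s ∈ P, ∃ s' ∈ P, s ≤ t ∧ t ≤ s' ∧ ∀ u ∈ Q, u ≤ s ∨ s' ≤ u}

theorem subset_hullAvoiding {P Q : Set ℝ} : P ⊆ hullAvoiding P Q := fun t ht =>
  ⟨t, ht, t, ht, le_rfl, le_rfl, fun u _ => le_total u t⟩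

theorem isClosed_hullAvoiding {P Q : Set ℝ} (hP : IsClosed P) : IsClosed (hullAvoiding P Q) := by
  rw [← isOpen_compl_iff, Metric.isOpen_iff]
  intro t ht
  obtain ⟨d, hd, hball⟩ := Metric.isOpen_iff.1 hP.isOpen_compl t
    fun htP => ht (subset_hullAvoiding htP)
  refine ⟨d, hd, fun t' ht' => ?_⟩
  rintro ⟨s, hs, s', hs', h1, h2, h3⟩
  rw [mem_ball, Real.dist_eq, abs_lt] at ht'
  refine ht ⟨s, hs, s', hs', ?_, ?_, h3⟩
  · by_contra! hlt
    exact hball (mem_ball.2 (by rw [Real.dist_eq, abs_lt]; constructor <;> linarith)) hs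
  · by_contra! hlt
    exact hball (mem_ball.2 (by rw [Real.dist_eq, abs_lt]; constructor <;> linarith)) hs'

theorem disjoint_hullAvoiding {P Q : Set ℝ} (hPQ : ∀ t ∈ P, t ∉ Q) :
    ∀ t ∈ hullAvoiding P Q, t ∉ hullAvoiding Q P := by
  rintro t ⟨s, hs, s', hs', h1, h2, h3⟩ ⟨σ, hσ, σ', hσ', h4, h5, h6⟩
  have hss : s < σ ∨ σ < s := lt_or_gt_of_ne fun h => hPQ s hs (h ▸ hσ)
  rcases hss with h | h
  · rcases h3 σ hσ with h7 | h7
    · linarith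
    · have : σ = s' := by linarith
      exact hPQ s' hs' (this ▸ hσ)
  · rcases h6 s hs with h7 | h7
    · linarith
    · have : s = σ' := by linarith
      exact hPQ s hs (this ▸ hσ')

theorem add_mem_hullAvoiding {P Q : Set ℝ} (hP : ∀ t ∈ P, ∀ k : ℤ, t + k ∈ P)
    (hQ : ∀ t ∈ Q, ∀ k : ℤ, t + k ∈ Q) {t : ℝ} (ht : t ∈ hullAvoiding P Q) (k : ℤ) :
    t + k ∈ hullAvoiding P Q := by
  obtain ⟨s, hs, s', hs', h1, h2, h3⟩ := ht
  refine ⟨s + k, hP s hs k, s' + k, hP s' hs' k, by linarith, by linarith, fun u hu => ?_⟩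
  have := h3 _ (hQ u hu (-k))
  push_cast at this
  exact this.imp (fun h => by linarith) (fun h => by linarith)

namespace JordanParam

variable {W : Set ℂ} {ψ : ℝ → ℂ}

theorem isCompact_image_hullAvoiding (h : JordanParam W ψ) {A B : Set ℂ} (hA : IsClosed A) :
    IsCompact (ψ '' hullAvoiding (ψ ⁻¹' A) (ψ ⁻¹' B)) := by
  have hper : ∀ C : Set ℂ, ∀ t ∈ ψ ⁻¹' C, ∀ k : ℤ, t + k ∈ ψ ⁻¹' C := fun C t ht k => by
    rw [mem_preimage, h.add_int]; exact ht
  have : ψ '' hullAvoiding (ψ ⁻¹' A) (ψ ⁻¹' B) =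
      ψ '' (Icc 0 1 ∩ hullAvoiding (ψ ⁻¹' A) (ψ ⁻¹' B)) := by
    refine Subset.antisymm ?_ (image_mono inter_subset_right)
    rintro _ ⟨t, ht, rfl⟩
    refine ⟨t + (-⌊t⌋ : ℤ), ⟨?_, add_mem_hullAvoiding (hper A) (hper B) ht _⟩, h.add_int _ _⟩
    push_cast
    constructor <;> linarith [Int.floor_le t, Int.lt_floor_add_one t]
  rw [this]
  exact (isCompact_Icc.inter_right
    (isClosed_hullAvoiding (hA.preimage h.continuous))).image h.continuous

/-- If `A ∪ M ∪ B` is a chain whose middle part `M` avoids `closure W`, then a component of the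
complement of `closure W ∪ A ∪ M ∪ B` which is cut off by this union, but neither by
`closure W ∪ A` nor by `closure W ∪ B` nor by `M`, clusters at a boundary arc running from `A`
to `B`. -/
theorem exists_gap (h : JordanParam W ψ) {A B M : Set ℂ} (hA : IsCompact A) (hB : IsCompact B)
    (hM : IsCompact M) (hAB : ∀ z ∈ A, z ∉ B) (hAM : (A ∩ M).Subsingleton)
    (hBM : (M ∩ B).Subsingleton) (hMW : ∀ z ∈ M, z ∉ closure W)
    (hAW : (A ∩ frontier W).Nonempty) (hBW : (B ∩ frontier W).Nonempty) {g q : ℂ}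
    (hqA : q ∈ connectedComponentIn (closure W ∪ A)ᶜ g)
    (hqB : q ∈ connectedComponentIn (closure W ∪ B)ᶜ g)
    (hqM : q ∈ connectedComponentIn Mᶜ g)
    (hqV : q ∉ connectedComponentIn (closure W ∪ (A ∪ M ∪ B))ᶜ g) :
    ∃ x y t₀ : ℝ, y < x + 1 ∧ (∀ t ∈ Ioo x y, ψ t ∉ A ∪ M ∪ B) ∧ t₀ ∈ Ioo x y ∧
      ψ t₀ ∈ closure (connectedComponentIn (closure W ∪ (A ∪ M ∪ B))ᶜ g) ∧
      (ψ x ∈ A ∧ ψ y ∈ B ∨ ψ x ∈ B ∧ ψ y ∈ A) := by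
  set P := ψ ⁻¹' A with hP
  set Q := ψ ⁻¹' B with hQ
  have hPper : ∀ t ∈ P, ∀ k : ℤ, t + k ∈ P := fun t ht k => by
    rw [hP, mem_preimage, h.add_int]; exact ht
  have hQper : ∀ t ∈ Q, ∀ k : ℤ, t + k ∈ Q := fun t ht k => by
    rw [hQ, mem_preimage, h.add_int]; exact ht
  have hPQ : ∀ t ∈ P, t ∉ Q := fun t ht => hAB _ ht
  have hPc : IsClosed P := hA.isClosed.preimage h.continuous
  have hQc : IsClosed Q := hB.isClosed.preimage h.continuous
  set T := hullAvoiding P Q with hT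
  set U := hullAvoiding Q P with hU
  have hψK : ∀ t, ψ t ∈ closure W := fun t => frontier_subset_closure (h.mem_frontier t)
  have hTA : ψ '' T ⊆ closure W := by rintro _ ⟨t, -, rfl⟩; exact hψK t
  have hUB : ψ '' U ⊆ closure W := by rintro _ ⟨t, -, rfl⟩; exact hψK t
  have hTU : ∀ z ∈ ψ '' T, z ∉ ψ '' U := by
    rintro _ ⟨t, ht, rfl⟩ ⟨u, hu, hut⟩
    obtain ⟨k, rfl⟩ := (h.eq_iff u t).1 hut
    exact disjoint_hullAvoiding hPQ _ ht (add_mem_hullAvoiding hQper hPper hu k)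
  have hATU : ∀ z ∈ A ∪ ψ '' T, z ∉ B ∪ ψ '' U := by
    rintro z (hzA | hzT) (hzB | hzU)
    · exact hAB z hzA hzB
    · obtain ⟨u, hu, rfl⟩ := id hzU
      exact hTU _ ⟨u, subset_hullAvoiding hzA, rfl⟩ hzU
    · obtain ⟨t, ht, rfl⟩ := id hzT
      exact hTU _ hzT ⟨t, subset_hullAvoiding hzB, rfl⟩
    · exact hTU z hzT hzU
  have hTk : IsCompact (ψ '' T) := h.isCompact_image_hullAvoiding hA.isClosed
  have hUk : IsCompact (ψ '' U) := h.isCompact_image_hullAvoiding hB.isClosed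
  have hq1 : q ∈ connectedComponentIn (A ∪ ψ '' T)ᶜ g :=
    connectedComponentIn_mono _ (compl_subset_compl.2
      (union_subset subset_union_right (hTA.trans subset_union_left))) hqA
  have hq2 : q ∈ connectedComponentIn (B ∪ ψ '' U)ᶜ g :=
    connectedComponentIn_mono _ (compl_subset_compl.2
      (union_subset subset_union_right (hUB.trans subset_union_left))) hqB
  have hq3 : q ∈ connectedComponentIn (A ∪ ψ '' T ∪ M)ᶜ g := by
    refine janiszewski (hA.union hTk) hM (Subsingleton.isPreconnected (hAM.anti ?_)) hq1 hqM
    rintro z ⟨hz, hzM⟩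
    exact ⟨hz.resolve_right fun hzT => hMW z hzM (hTA hzT), hzM⟩
  set Y := A ∪ ψ '' T ∪ M ∪ (B ∪ ψ '' U) with hY
  have hq4 : q ∈ connectedComponentIn Yᶜ g := by
    refine janiszewski ((hA.union hTk).union hM) (hB.union hUk)
      (Subsingleton.isPreconnected (hBM.anti ?_)) hq3 hq2
    rintro z ⟨hz, hz'⟩
    have hzM := hz.resolve_left fun hzA => hATU z hzA hz'
    exact ⟨hzM, hz'.resolve_right fun hzU => hMW z hzM (hUB hzU)⟩
  have hXo : IsOpen (closure W ∪ (A ∪ M ∪ B))ᶜ :=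
    (h.isCompact_closure.union ((hA.union hM).union hB)).isClosed.isOpen_compl
  set V := connectedComponentIn (closure W ∪ (A ∪ M ∪ B))ᶜ g with hV
  have hgY : g ∉ Y := mem_of_mem_connectedComponentIn hq4
  have hgV : g ∈ V := by
    refine mem_connectedComponentIn ?_
    rintro (hg | (hg | hg) | hg)
    · exact mem_of_mem_connectedComponentIn hqA (Or.inl hg)
    · exact hgY (Or.inl (Or.inl (Or.inl hg)))
    · exact hgY (Or.inl (Or.inr hg))
    · exact hgY (Or.inr (Or.inl hg))
  obtain ⟨z, hzY, hzf⟩ : ∃ z ∈ connectedComponentIn Yᶜ g, z ∈ frontier V := by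
    by_contra! hcon
    exact hqV (isPreconnected_connectedComponentIn.subset_of_disjoint_frontier (A := V)
      ⟨g, mem_connectedComponentIn hgY, hgV⟩ hcon hq4)
  replace hzY : z ∉ Y := connectedComponentIn_subset _ _ hzY
  have hzX := frontier_connectedComponentIn_subset hXo g hzf
  rw [compl_compl] at hzX
  have hzK : z ∈ closure W := hzX.resolve_right fun hz => by
    rcases hz with (hz | hz) | hz
    · exact hzY (Or.inl (Or.inl (Or.inl hz)))
    · exact hzY (Or.inl (Or.inr hz))
    · exact hzY (Or.inr (Or.inl hz))
  have hzJ : z ∈ frontier W := by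
    rw [h.isOpen.frontier_eq]
    refine ⟨hzK, fun hzW => ?_⟩
    obtain ⟨w, hwW, hwV⟩ := mem_closure_iff.1 (frontier_subset_closure hzf) _ h.isOpen hzW
    exact connectedComponentIn_subset _ _ hwV (Or.inl (subset_closure hwW))
  rw [← h.range_eq] at hzJ
  obtain ⟨t₀, rfl⟩ := hzJ
  have ht₀T : t₀ ∉ T := fun ht => hzY (Or.inl (Or.inl (Or.inr ⟨t₀, ht, rfl⟩)))
  have ht₀U : t₀ ∉ U := fun ht => hzY (Or.inr (Or.inr ⟨t₀, ht, rfl⟩))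
  have ht₀ : t₀ ∉ P ∪ Q := fun ht =>
    ht.elim (fun ht => ht₀T (subset_hullAvoiding ht)) fun ht => ht₀U (subset_hullAvoiding ht)
  have hPmeet : ∀ s, ∃ t ∈ Ico s (s + 1), t ∈ P := fun s => by
    obtain ⟨z, hzA, hzW⟩ := hAW
    obtain ⟨t, ht, rfl⟩ := h.exists_mem_Ico hzW s
    exact ⟨t, ht, hzA⟩
  have hQmeet : ∀ s, ∃ t ∈ Ico s (s + 1), t ∈ Q := fun s => by
    obtain ⟨z, hzA, hzW⟩ := hBW
    obtain ⟨t, ht, rfl⟩ := h.exists_mem_Ico hzW s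
    exact ⟨t, ht, hzA⟩
  have hclosed : IsClosed (P ∪ Q) := hPc.union hQc
  obtain ⟨x, ⟨⟨hx1, hx2⟩, hxPQ⟩, hxmax⟩ := (isCompact_Icc.inter_right hclosed :
      IsCompact (Icc (t₀ - 1) t₀ ∩ (P ∪ Q))).exists_isGreatest (by
    obtain ⟨t, ht, htP⟩ := hPmeet (t₀ - 1)
    exact ⟨t, ⟨ht.1, by linarith [ht.2]⟩, Or.inl htP⟩)
  obtain ⟨y, ⟨⟨hy1, hy2⟩, hyPQ⟩, hymin⟩ := (isCompact_Icc.inter_right hclosed :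
      IsCompact (Icc t₀ (t₀ + 1) ∩ (P ∪ Q))).exists_isLeast (by
    obtain ⟨t, ht, htP⟩ := hPmeet t₀
    exact ⟨t, ⟨ht.1, ht.2.le⟩, Or.inl htP⟩)
  have hxt : x < t₀ := hx2.lt_of_ne fun hc => ht₀ (hc ▸ hxPQ)
  have hty : t₀ < y := hy1.lt_of_ne fun hc => ht₀ (hc ▸ hyPQ)
  have hfree : ∀ u ∈ Ioo x y, u ∉ P ∪ Q := by
    intro u hu huPQ
    rcases le_total u t₀ with hut | hut
    · exact (hxmax ⟨⟨by linarith [hu.1], hut⟩, huPQ⟩).not_gt hu.1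
    · exact (hymin ⟨⟨hut, by linarith [hu.2]⟩, huPQ⟩).not_gt hu.2
  have hcut : ∀ u ∈ P ∪ Q, u ≤ x ∨ y ≤ u := fun u hu => by
    by_contra! hc
    exact hfree u hc hu
  have hends : x ∈ P ∧ y ∈ Q ∨ x ∈ Q ∧ y ∈ P := by
    rcases hxPQ with hx | hx <;> rcases hyPQ with hy | hy
    · exact absurd ⟨x, hx, y, hy, hx2, hy1, fun u hu => hcut u (Or.inr hu)⟩ ht₀T
    · exact Or.inl ⟨hx, hy⟩
    · exact Or.inr ⟨hx, hy⟩
    · exact absurd ⟨x, hx, y, hy, hx2, hy1, fun u hu => hcut u (Or.inl hu)⟩ ht₀U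
  refine ⟨x, y, t₀, ?_, ?_, ⟨hxt, hty⟩, frontier_subset_closure hzf, hends⟩
  · rcases hends with ⟨hx, hy⟩ | ⟨hx, hy⟩
    · obtain ⟨t, ht, htQ⟩ := hQmeet x
      rcases hcut t (Or.inr htQ) with h1 | h1
      · exact absurd htQ (hPQ t (by rwa [le_antisymm h1 ht.1]))
      · exact h1.trans_lt ht.2
    · obtain ⟨t, ht, htP⟩ := hPmeet x
      rcases hcut t (Or.inl htP) with h1 | h1
      · exact absurd (by rwa [le_antisymm h1 ht.1] : t ∈ Q) (hPQ t htP)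
      · exact h1.trans_lt ht.2
  · rintro t ht ((hA | hM) | hB)
    · exact hfree t ht (Or.inl hA)
    · exact hMW _ hM (hψK t)
    · exact hfree t ht (Or.inr hB)

end JordanParam

/-- A decreasing intersection of compact connected sets is connected. -/
theorem isPreconnected_iInter_of_antitone {K : ℕ → Set ℂ} (hK : Antitone K)
    (hc : ∀ n, IsCompact (K n)) (hp : ∀ n, IsPreconnected (K n)) :
    IsPreconnected (⋂ n, K n) := by
  have hcc : IsCompact (⋂ n, K n) :=
    (hc 0).of_isClosed_subset (isClosed_iInter fun n => (hc n).isClosed) (iInter_subset K 0)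
  rw [isPreconnected_iff_subset_of_fully_disjoint_closed hcc.isClosed]
  intro u v hu hv huv hd
  obtain ⟨U, V, hU, hV, hUu, hVv, hUV⟩ := SeparatedNhds.of_isCompact_isCompact
    (hcc.inter_right hu) (hcc.inter_right hv)
    (hd.mono inter_subset_right inter_subset_right)
  obtain ⟨n, hn⟩ := exists_subset_nhds_of_isCompact hK.directed_ge hc
    (U := U ∪ V) fun x hx => (hU.union hV).mem_nhds ((huv hx).imp (fun h => hUu ⟨hx, h⟩)
      fun h => hVv ⟨hx, h⟩)
  have hsub := iInter_subset K n
  rcases isPreconnected_iff_subset_of_disjoint.1 (hp n) U V hU hV hn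
    (by rw [hUV.inter_eq, inter_empty]) with h | h
  · exact Or.inl fun x hx => (huv hx).resolve_right fun hxv =>
      hUV.notMem_of_mem_left (h (hsub hx)) (hVv ⟨hx, hxv⟩)
  · exact Or.inr fun x hx => (huv hx).resolve_left fun hxu =>
      hUV.notMem_of_mem_left (hUu ⟨hx, hxu⟩) (h (hsub hx))

/-- If an arc `γ` whose two ends meet `closure W` separates `g` from `q` together with
`closure W`, but the ends of `γ` do not, then some cross-cut of the exterior with distant endpoints
has its region inside the component of `g`. -/
theorem JordanParam.exists_crossCut_of_separates {W : Set ℂ} {ψ : ℝ → ℂ} (h : JordanParam W ψ)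
    {γ : ℝ → ℂ} (hγ : ContinuousOn γ (Icc 0 1)) (hi : InjOn γ (Icc 0 1)) {δ d : ℝ} (hδ : 0 < δ)
    (hδ' : δ < 1 / 2) (hA : ∀ t ∈ Icc 0 δ, dist (γ t) (γ 0) < d)
    (hB : ∀ t ∈ Icc (1 - δ) 1, dist (γ t) (γ 1) < d) (hd : 4 * d ≤ dist (γ 0) (γ 1))
    (h0 : γ 0 ∈ closure W) (h1 : γ 1 ∈ closure W)
    (hM : ∀ t ∈ Icc δ (1 - δ), γ t ∉ closure W) {g q : ℂ} (hg : g ∉ γ '' Icc 0 1)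
    (hq : q ∉ γ '' Icc 0 1)
    (hqA : q ∈ connectedComponentIn (closure W ∪ γ '' Icc 0 δ)ᶜ g)
    (hqB : q ∈ connectedComponentIn (closure W ∪ γ '' Icc (1 - δ) 1)ᶜ g)
    (hqV : q ∉ connectedComponentIn (closure W ∪ γ '' Icc 0 1)ᶜ g)
    (hb : Bornology.IsBounded (connectedComponentIn (closure W ∪ γ '' Icc 0 1)ᶜ g)) :
    ∃ f, CrossCut (closure W) f ∧ d < ‖f 0 - f 1‖ ∧
      CrossCutRegion (closure W) f ⊆ connectedComponentIn (closure W ∪ γ '' Icc 0 1)ᶜ g := by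
  have hd0 : 0 < d := by
    have := hA 0 ⟨le_rfl, hδ.le⟩
    rwa [dist_self] at this
  have sA : Icc 0 δ ⊆ Icc 0 1 := Icc_subset_Icc_right (by linarith)
  have sM : Icc δ (1 - δ) ⊆ Icc 0 1 := Icc_subset_Icc hδ.le (by linarith)
  have sB : Icc (1 - δ) 1 ⊆ Icc 0 1 := Icc_subset_Icc_left (by linarith)
  have hsplit : γ '' Icc 0 1 = γ '' Icc 0 δ ∪ γ '' Icc δ (1 - δ) ∪ γ '' Icc (1 - δ) 1 := by
    rw [← image_union, ← image_union, Icc_union_Icc_eq_Icc hδ.le (by linarith),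
      Icc_union_Icc_eq_Icc (by linarith) (by linarith)]
  have hmeet : ∀ I : Set ℝ, I ⊆ Icc 0 1 → IsPreconnected I → ∀ s ∈ I, ∀ t ∈ I,
      γ s ∈ closure W → γ t ∉ closure W → (γ '' I ∩ frontier W).Nonempty := by
    intro I hI hIp s hs t ht hsW htW
    by_contra hcon
    refine htW ((hIp.image γ (hγ.mono hI)).subset_of_disjoint_frontier
      ⟨γ s, mem_image_of_mem γ hs, hsW⟩ (fun z hz hzf => hcon ⟨z, hz, ?_⟩) (mem_image_of_mem γ ht))
    exact frontier_closure_subset hzf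
  have hAB : ∀ z ∈ γ '' Icc 0 δ, z ∉ γ '' Icc (1 - δ) 1 := by
    rintro _ ⟨s, hs, rfl⟩ ⟨t, ht, hts⟩
    have := hi (sB ht) (sA hs) hts
    linarith [hs.2, ht.1]
  have hAM : (γ '' Icc 0 δ ∩ γ '' Icc δ (1 - δ)).Subsingleton := by
    refine subsingleton_singleton.anti (t := {γ δ}) ?_
    rintro _ ⟨⟨s, hs, rfl⟩, t, ht, hts⟩
    have := hi (sM ht) (sA hs) hts
    rw [mem_singleton_iff, le_antisymm hs.2 (this ▸ ht.1)]
  have hBM : (γ '' Icc δ (1 - δ) ∩ γ '' Icc (1 - δ) 1).Subsingleton := by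
    refine subsingleton_singleton.anti (t := {γ (1 - δ)}) ?_
    rintro _ ⟨⟨s, hs, rfl⟩, t, ht, hts⟩
    have := hi (sB ht) (sM hs) hts
    rw [mem_singleton_iff, le_antisymm hs.2 (this ▸ ht.1)]
  have hMW : ∀ z ∈ γ '' Icc δ (1 - δ), z ∉ closure W := by
    rintro _ ⟨t, ht, rfl⟩
    exact hM t ht
  have hqM : q ∈ connectedComponentIn (γ '' Icc δ (1 - δ))ᶜ g :=
    (isPreconnected_compl_arc (hγ.mono sM) (hi.mono sM)).subset_connectedComponentIn
      (fun hc => hg (image_mono sM hc)) subset_rfl fun hc => hq (image_mono sM hc)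
  rw [hsplit] at hqV
  obtain ⟨x, y, t₀, hyx, hfree, ht₀, ht₀V, hends⟩ := h.exists_gap
    (isCompact_Icc.image_of_continuousOn (hγ.mono sA))
    (isCompact_Icc.image_of_continuousOn (hγ.mono sB))
    (isCompact_Icc.image_of_continuousOn (hγ.mono sM)) hAB hAM hBM hMW
    (hmeet _ sA isPreconnected_Icc 0 ⟨le_rfl, hδ.le⟩ δ ⟨hδ.le, le_rfl⟩ h0
      (hM δ ⟨le_rfl, by linarith⟩))
    (hmeet _ sB isPreconnected_Icc 1 ⟨by linarith, le_rfl⟩ (1 - δ) ⟨le_rfl, by linarith⟩ h1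
      (hM (1 - δ) ⟨by linarith, le_rfl⟩))
    hqA hqB hqM hqV
  rw [← hsplit] at hfree ht₀V
  have hx : ψ x ∈ γ '' Icc 0 1 :=
    hends.elim (fun h => image_mono sA h.1) fun h => image_mono sB h.1
  obtain ⟨f, hf, hf0, hf1, hfV⟩ := h.exists_crossCut (isCompact_Icc.image_of_continuousOn hγ)
    (isPreconnected_Icc.image γ hγ) hb hyx hfree hx ht₀ ht₀V (half_pos hd0)
  refine ⟨f, hf, ?_, hfV⟩
  rw [← dist_eq_norm]
  have key : ∀ a b p q : ℂ, dist a (γ 0) < d → dist b (γ 1) < d → dist p a < d / 2 →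
      dist q b < d / 2 → d < dist p q := by
    intro a b p q h1 h2 h3 h4
    have e1 := dist_triangle4 (γ 0) p q (γ 1)
    have e2 := dist_triangle p a (γ 0)
    have e3 := dist_triangle q b (γ 1)
    rw [dist_comm (γ 0) p] at e1
    linarith
  rcases hends with ⟨⟨s, hs, hsx⟩, ⟨t, ht, hty⟩⟩ | ⟨⟨s, hs, hsx⟩, ⟨t, ht, hty⟩⟩
  · rw [← hsx] at hf0
    rw [← hty] at hf1
    exact key _ _ _ _ (hA s hs) (hB t ht) hf0 hf1
  · rw [← hsx] at hf0
    rw [← hty] at hf1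
    rw [dist_comm]
    exact key _ _ _ _ (hA t ht) (hB s hs) hf1 hf0

theorem infDist_frontier_le {W : Set ℂ} {ψ : ℝ → ℂ} (h : JordanParam W ψ) {z : ℂ}
    (hz : z ∈ closure W) :
    infDist z (frontier (closure W)) ≤ hausdorffDist (frontier (closure W)) (closure W) := by
  have h0 : ψ 0 ∈ closure W := frontier_subset_closure (h.mem_frontier 0)
  have hb := h.isBounded.closure
  have hne : (frontier (closure W)).Nonempty := by
    refine ⟨ψ 0, subset_closure h0, fun hi => ?_⟩
    have := h.mem_closure_compl 0
    rw [closure_compl] at this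
    exact this hi
  rw [hausdorffDist_comm]
  refine infDist_le_hausdorffDist_of_mem hz (hausdorffEDist_ne_top_of_nonempty_of_bounded ⟨_, h0⟩
    hne hb (hb.subset ?_))
  exact isClosed_closure.frontier_subset

theorem exists_forall_dist_lt_endpoints {γ : ℝ → ℂ} (hγ : ContinuousOn γ (Icc 0 1)) {d : ℝ}
    (hd : 0 < d) :
    ∃ δ > 0, δ < 1 / 2 ∧ (∀ t ∈ Icc 0 δ, dist (γ t) (γ 0) < d) ∧
      ∀ t ∈ Icc (1 - δ) 1, dist (γ t) (γ 1) < d := by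
  obtain ⟨δ₀, hδ₀, h0⟩ := Metric.continuousOn_iff.1 hγ 0 ⟨le_rfl, zero_le_one⟩ d hd
  obtain ⟨δ₁, hδ₁, h1⟩ := Metric.continuousOn_iff.1 hγ 1 ⟨zero_le_one, le_rfl⟩ d hd
  obtain ⟨δ, hδ, hlt⟩ := exists_between (lt_min (lt_min hδ₀ hδ₁) (one_half_pos (α := ℝ)))
  obtain ⟨hlt', h2⟩ := lt_min_iff.1 hlt
  obtain ⟨h3, h4⟩ := lt_min_iff.1 hlt'
  refine ⟨δ, hδ, h2, fun t ht => h0 t ⟨ht.1, by linarith [ht.2]⟩ ?_,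
    fun t ht => h1 t ⟨by linarith [ht.1], ht.2⟩ ?_⟩
  · rw [Real.dist_eq, abs_lt]
    constructor <;> linarith [ht.1, ht.2]
  · rw [Real.dist_eq, abs_lt]
    constructor <;> linarith [ht.1, ht.2]

theorem isPreconnected_compl_iInter {K : ℕ → Set ℂ} (hK : Antitone K)
    (hb : Bornology.IsBounded (K 0))
    (hp : ∀ n, IsPreconnected (K n)ᶜ) : IsPreconnected (⋂ n, K n)ᶜ := by
  obtain ⟨p, hp0⟩ : ∃ p, p ∉ K 0 := by
    by_contra! h
    exact NormedSpace.unbounded_univ ℂ ℂ (hb.subset fun x _ => h x)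
  rw [compl_iInter]
  exact isPreconnected_iUnion ⟨p, mem_iInter.2 fun n hn => hp0 (hK (Nat.zero_le n) hn)⟩ hp

/-- If a decreasing sequence of closed Jordan domains `K_n ∋ 0` satisfies the Hausdorff
closeness conditions (a) and the cross-cut engulfing conditions (b) relative to a
decreasing null sequence `r_n > 0`, then the intersection `K_∞` has the property that
every cross-cut `γ` of `ℂ ∖ K_∞` satisfies `K_∞ ⊆ closure (G(γ))`. -/
theorem nested_jordan_full_impressions
    (K : ℕ → Set ℂ) (r : ℕ → ℝ)
    (hJordan : ∀ n, ∃ W : Set ℂ, JordanDomain W ∧ (0 : ℂ) ∈ W ∧ K n = closure W)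
    (hdec : ∀ n, K (n + 1) ⊆ K n)
    (hrpos : ∀ n, 0 < r n)
    (hrdec : Antitone r)
    (hrlim : Filter.Tendsto r Filter.atTop (nhds 0))
    (ha : ∀ n,
      Metric.hausdorffDist (K n) (frontier (K (n + 1))) < r n / 2 ∧
      Metric.hausdorffDist (frontier (K (n + 1))) (K (n + 1)) < r (n + 1) / 2)
    (hb : ∀ n, ∀ γ : ℝ → ℂ, CrossCut (K (n + 1)) γ →
      Metric.infDist (γ 0) (frontier (K n)) < r n →
      Metric.infDist (γ 1) (frontier (K n)) < r n →
      r n < ‖γ 0 - γ 1‖ →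
      ∀ z ∈ K (n + 1),
        Metric.infDist z (closure (CrossCutRegion (K (n + 1)) γ)) < r n) :
    ∀ γ : ℝ → ℂ, CrossCut (⋂ n, K n) γ →
      (⋂ n, K n) ⊆ closure (CrossCutRegion (⋂ n, K n) γ) := by
  intro γ hCC
  have hLΓ := hCC.inter_image
  obtain ⟨hγ, hi, hγ0, hγ1, hne, hγK⟩ := hCC
  choose W hW h0W hKW using hJordan
  choose ψ hψ using fun n => (hW n).exists_param
  have hanti : Antitone K := antitone_nat_of_succ_le hdec
  have hKc : ∀ n, IsCompact (K n) := fun n => hKW n ▸ (hψ n).isCompact_closure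
  have hKp : ∀ n, IsPreconnected (K n) := fun n =>
    hKW n ▸ (hψ n).isConnected.isPreconnected.closure
  have hKp' : ∀ n, IsPreconnected (K n)ᶜ := fun n => hKW n ▸ (hψ n).isPreconnected_compl
  set L := ⋂ n, K n with hL
  have hLK : ∀ n, L ⊆ K n := iInter_subset K
  have hLc : IsCompact L :=
    (hKc 0).of_isClosed_subset (isClosed_iInter fun n => (hKc n).isClosed) (hLK 0)
  have hLp' : IsPreconnected Lᶜ := isPreconnected_compl_iInter hanti (hKc 0).isBounded hKp'
  have hΓc : IsCompact (γ '' Icc 0 1) := isCompact_Icc.image_of_continuousOn hγ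
  obtain ⟨g, hg, hgb⟩ := exists_isBounded_connectedComponentIn (hLc.union hΓc)
    (not_isPreconnected_compl_union hLc.isClosed hΓc.isClosed
      (isPreconnected_iInter_of_antitone hanti hKc hKp) (isPreconnected_Icc.image γ hγ) hLp'
      (isPreconnected_compl_arc hγ hi) hne hLΓ)
  obtain ⟨q, hqn⟩ : ∃ q, q ∉ connectedComponentIn (L ∪ γ '' Icc 0 1)ᶜ g ∪ (L ∪ γ '' Icc 0 1) := by
    by_contra! h
    exact NormedSpace.unbounded_univ ℂ ℂ
      ((hgb.union (hLc.union hΓc).isBounded).subset fun x _ => h x)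
  rw [mem_union, mem_union, not_or, not_or] at hqn
  obtain ⟨hqG, hqL, hqΓ⟩ := hqn
  rw [mem_union, not_or] at hg
  obtain ⟨hgL, hgΓ⟩ := hg
  obtain ⟨ε, hε, hqε⟩ := exists_infDist_joined hLc.isClosed ⟨_, hγ0⟩ hLp' hgL hqL
  have hdist : 0 < dist (γ 0) (γ 1) := dist_pos.2 hne
  obtain ⟨d, hd, hdε, hdγ⟩ : ∃ d > 0, d ≤ ε ∧ 4 * d ≤ dist (γ 0) (γ 1) :=
    ⟨min ε (dist (γ 0) (γ 1) / 4), lt_min hε (by linarith), min_le_left _ _, by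
      linarith [min_le_right ε (dist (γ 0) (γ 1) / 4)]⟩
  obtain ⟨δ, hδ, hδ', hA, hB⟩ := exists_forall_dist_lt_endpoints hγ hd
  have hMc : IsCompact (γ '' Icc δ (1 - δ)) := isCompact_Icc.image_of_continuousOn
    (hγ.mono (Icc_subset_Icc hδ.le (by linarith)))
  obtain ⟨N, hN⟩ := exists_subset_nhds_of_isCompact hanti.directed_ge hKc
    (U := {z | infDist z L < ε} ∩ (γ '' Icc δ (1 - δ))ᶜ) fun x hx =>
      ((isOpen_lt (continuous_infDist_pt L) continuous_const).inter
        hMc.isClosed.isOpen_compl).mem_nhds ⟨(infDist_zero_of_mem hx).trans_lt hε, by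
          rintro ⟨t, ht, rfl⟩
          exact hγK t ⟨hδ.trans_le ht.1, by linarith [ht.2]⟩ hx⟩
  have hjoin : ∀ n, N ≤ n → ∀ S : Set ℝ, ∀ a ∈ L, (∀ t ∈ S, dist (γ t) a < d) →
      q ∈ connectedComponentIn (K n ∪ γ '' S)ᶜ g := by
    intro n hn S a haL hS
    refine connectedComponentIn_mono _ (fun z hz hzK => ?_) hqε
    rw [mem_ofPred_eq] at hz
    rcases hzK with hzK | ⟨t, ht, rfl⟩
    · exact hz.not_gt (hN (hanti hn hzK)).1
    · linarith [infDist_le_dist_of_mem haL (x := γ t), hS t ht]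
  intro z hz
  rw [Metric.mem_closure_iff]
  intro e he
  obtain ⟨N', hN'⟩ := eventually_atTop.1 (hrlim.eventually (gt_mem_nhds (lt_min hd he)))
  obtain ⟨m, hm, hm'⟩ : ∃ m, N ≤ m ∧ N' ≤ m := ⟨max N N', le_max_left _ _, le_max_right _ _⟩
  obtain ⟨hrd, hre⟩ := lt_min_iff.1 (hN' (m + 1) (by omega))
  have hsub : connectedComponentIn (K (m + 1 + 1) ∪ γ '' Icc 0 1)ᶜ g ⊆
      connectedComponentIn (L ∪ γ '' Icc 0 1)ᶜ g :=
    connectedComponentIn_mono _ (compl_subset_compl.2 (union_subset_union_left _ (hLK _)))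
  obtain ⟨f, hf, hfd, hfV⟩ : ∃ f, CrossCut (K (m + 1 + 1)) f ∧ d < ‖f 0 - f 1‖ ∧
      CrossCutRegion (K (m + 1 + 1)) f ⊆
        connectedComponentIn (K (m + 1 + 1) ∪ γ '' Icc 0 1)ᶜ g := by
    have hM : ∀ t ∈ Icc δ (1 - δ), γ t ∉ K (m + 1 + 1) := fun t ht htK =>
      (hN (hanti (by omega) htK)).2 (mem_image_of_mem γ ht)
    have hqA := hjoin (m + 1 + 1) (by omega) _ _ hγ0 hA
    have hqB := hjoin (m + 1 + 1) (by omega) _ _ hγ1 hB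
    have h0 := hLK (m + 1 + 1) hγ0
    have h1 := hLK (m + 1 + 1) hγ1
    have hqV := fun hq => hqG (hsub hq)
    have hbd := hgb.subset hsub
    rw [hKW (m + 1 + 1)] at *
    exact (hψ (m + 1 + 1)).exists_crossCut_of_separates hγ hi hδ hδ' hA hB hdγ h0 h1 hM hgΓ hqΓ
      hqA hqB hqV hbd
  have hnear : ∀ w ∈ K (m + 1 + 1), infDist w (frontier (K (m + 1))) < r (m + 1) := by
    intro w hw
    have h1 := (ha m).2
    have h2 := hdec (m + 1) hw
    rw [hKW (m + 1)] at h1 h2 ⊢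
    linarith [infDist_frontier_le (hψ (m + 1)) h2, hrpos (m + 1)]
  have hclose := hb (m + 1) f hf (hnear _ hf.2.2.1) (hnear _ hf.2.2.2.1) (hrd.trans hfd) z
    (hLK _ hz)
  have hreg : (CrossCutRegion (K (m + 1 + 1)) f).Nonempty := by
    rw [hKW (m + 1 + 1)] at hf ⊢
    exact (hψ (m + 1 + 1)).crossCutRegion_nonempty hf
  rw [infDist_closure, infDist_lt_iff hreg] at hclose
  obtain ⟨y, hy, hzy⟩ := hclose
  have hyG := hsub (hfV hy)
  exact ⟨y, ⟨connectedComponentIn_subset _ _ hyG, connectedComponentIn_eq hyG ▸ hgb⟩,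
    hzy.trans hre⟩
end
end

section
/- Let α ∈ ℝ and let f : 𝔻 → ℂ be a holomorphic injective map with f(0) = 0 and f'(0) = e^{2πiα}. Then there exists a unique holomorphic map F : ℍ → ℂ such that E(F(z)) = f(E(z)) for all z ∈ ℍ and F(z) − z − α → 0 as Im z → +∞; moreover this F is injective and satisfies F(z + 1) = F(z) + 1 for all z ∈ ℍ. -/
open Complex Metric Set Filter

noncomputable section

/-- The universal covering `E(z) = e^{2πiz}`, mapping `ℍ` onto `𝔻 ∖ {0}`. -/
def E (z : ℂ) : ℂ := Complex.exp (2 * Real.pi * Complex.I * z)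

/-- The defining properties of the normalized lift `F` of `f` to the upper half-plane:
`F` is holomorphic on `ℍ`, satisfies `E ∘ F = f ∘ E` on `ℍ`, and
`F(z) - z - α → 0` as `Im z → +∞`. -/
def IsNormalizedLift (α : ℝ) (f F : ℂ → ℂ) : Prop :=
  DifferentiableOn ℂ F {z : ℂ | 0 < z.im} ∧
  (∀ z ∈ {z : ℂ | 0 < z.im}, E (F z) = f (E z)) ∧
  Filter.Tendsto (fun z => F z - z - (α : ℂ))
    (Filter.comap Complex.im Filter.atTop ⊓ Filter.principal {z : ℂ | 0 < z.im})
    (nhds 0)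

/-- A nonvanishing holomorphic function on a disk has a holomorphic logarithm with any prescribed
admissible value at the center. -/
lemma DifferentiableOn.exists_eqOn_exp_ball {g : ℂ → ℂ} {c a : ℂ} {r : ℝ} (hr : 0 < r)
    (hg : DifferentiableOn ℂ g (ball c r)) (hg0 : ∀ w ∈ ball c r, g w ≠ 0)
    (ha : g c = Complex.exp a) :
    ∃ h : ℂ → ℂ, DifferentiableOn ℂ h (ball c r) ∧ h c = a ∧
      ∀ w ∈ ball c r, Complex.exp (h w) = g w := by
  obtain ⟨h, hca, hh⟩ :=
    ((hg.deriv isOpen_ball).div hg hg0).isExactOn_ball.with_val_at c a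
  refine ⟨h, fun w hw => (hh w hw).differentiableAt.differentiableWithinAt, hca, fun w hw => ?_⟩
  have key : ∀ w ∈ ball c r, HasDerivAt (fun w => g w * Complex.exp (-h w)) 0 w := by
    intro w hw
    have h1 := (hg.differentiableAt (isOpen_ball.mem_nhds hw)).hasDerivAt
    refine (h1.mul (hh w hw).neg.cexp).congr_deriv ?_
    have := hg0 w hw
    simp only [Pi.div_apply, Pi.neg_apply]
    field_simp
    ring
  have hconst := isOpen_ball.is_const_of_deriv_eq_zero (convex_ball c r).isPreconnected
    (fun w hw => (key w hw).differentiableAt.differentiableWithinAt)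
    (fun w hw => (key w hw).deriv) hw (mem_ball_self hr)
  simp only [hca, ha, ← Complex.exp_add, add_neg_cancel, Complex.exp_zero] at hconst
  rw [Complex.exp_neg] at hconst
  field_simp at hconst
  exact hconst.symm

lemma E_ne_zero (z : ℂ) : E z ≠ 0 := Complex.exp_ne_zero _

lemma E_add (z w : ℂ) : E (z + w) = E z * E w := by
  simp only [E, mul_add, Complex.exp_add]

lemma E_sub (z w : ℂ) : E (z - w) = E z / E w := by
  simp only [E, mul_sub, Complex.exp_sub]

lemma E_add_one (z : ℂ) : E (z + 1) = E z := by
  rw [E_add]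
  simp [E, Complex.exp_two_pi_mul_I]

lemma differentiable_E : Differentiable ℂ E := by
  unfold E
  fun_prop

lemma norm_E (z : ℂ) : ‖E z‖ = Real.exp (-(2 * Real.pi * z.im)) := by
  simp [E, Complex.norm_exp]

lemma E_mem_ball {z : ℂ} (hz : 0 < z.im) : E z ∈ ball (0 : ℂ) 1 := by
  rw [mem_ball_zero_iff, norm_E, Real.exp_lt_one_iff, neg_lt_zero]
  positivity

lemma tendsto_E_comap_im_atTop : Tendsto E (comap Complex.im atTop) (nhds 0) := by
  rw [tendsto_zero_iff_norm_tendsto_zero]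
  simp only [norm_E]
  exact Real.tendsto_exp_neg_atTop_nhds_zero.comp
    (tendsto_comap.const_mul_atTop Real.two_pi_pos)

instance neBot_comap_im_atTop_inf_principal :
    NeBot (comap Complex.im atTop ⊓ principal {z : ℂ | 0 < z.im}) := by
  have : Tendsto (fun t : ℝ => (t : ℂ) * Complex.I) atTop
      (comap Complex.im atTop ⊓ principal {z : ℂ | 0 < z.im}) := by
    refine tendsto_inf.2 ⟨tendsto_comap_iff.2 ?_, tendsto_principal.2 ?_⟩
    · exact tendsto_id.congr fun t => by simp
    · filter_upwards [eventually_gt_atTop 0] with t ht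
      simpa using ht
  exact this.neBot

/-- A holomorphic function on a connected open set that lifts the constant `1` through `E`
is constant. -/
lemma IsPreconnected.eq_of_E_eq_one {U : Set ℂ} (hUo : IsOpen U) (hUc : IsPreconnected U)
    {G : ℂ → ℂ} (hG : DifferentiableOn ℂ G U) (hE : ∀ z ∈ U, E (G z) = 1)
    {z w : ℂ} (hz : z ∈ U) (hw : w ∈ U) : G z = G w := by
  refine hUo.is_const_of_deriv_eq_zero hUc hG (fun u hu => ?_) hz hw
  have h1 := (hG.differentiableAt (hUo.mem_nhds hu)).hasDerivAt
  have h2 : HasDerivAt (fun z => E (G z)) (E (G u) * (2 * Real.pi * Complex.I * deriv G u)) u :=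
    (h1.const_mul (2 * Real.pi * Complex.I)).cexp
  have h3 : HasDerivAt (fun z => E (G z)) 0 u :=
    (hasDerivAt_const u (1 : ℂ)).congr_of_eventuallyEq
      ((hUo.eventually_mem hu).mono hE)
  have h4 := h2.unique h3
  rw [hE u hu, one_mul] at h4
  exact (mul_eq_zero.1 h4).resolve_left Complex.two_pi_I_ne_zero

lemma IsNormalizedLift.eqOn {α : ℝ} {f F F' : ℂ → ℂ} (hF : IsNormalizedLift α f F)
    (hF' : IsNormalizedLift α f F') : EqOn F' F {z : ℂ | 0 < z.im} := by
  intro z hz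
  have hopen : IsOpen {z : ℂ | 0 < z.im} := isOpen_lt continuous_const Complex.continuous_im
  have hconst : ∀ w ∈ {z : ℂ | 0 < z.im}, F' w - F w = F' z - F z := fun w hw =>
    IsPreconnected.eq_of_E_eq_one (G := fun z => F' z - F z) hopen
      (convex_halfSpace_im_gt 0).isPreconnected
      (hF'.1.sub hF.1)
      (fun u hu => by rw [E_sub, hF'.2.1 u hu, hF.2.1 u hu, ← hF.2.1 u hu,
        div_self (E_ne_zero _)]) hw hz
  have hlim := hF'.2.2.sub hF.2.2
  rw [sub_zero] at hlim
  have hlim' : Tendsto (fun _ : ℂ => F' z - F z)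
      (comap Complex.im atTop ⊓ principal {z : ℂ | 0 < z.im}) (nhds 0) := by
    refine hlim.congr' ?_
    filter_upwards [mem_inf_of_right (mem_principal_self _)] with w hw
    rw [← hconst w hw]
    ring
  exact sub_eq_zero.1 (tendsto_nhds_unique tendsto_const_nhds hlim')

/-- A univalent map `f` of the unit disk with `f(0) = 0`, `f'(0) = e^{2πiα}` has a
unique normalized lift `F` to the upper half-plane (`E ∘ F = f ∘ E`,
`F(z) - z - α → 0` as `Im z → +∞`); moreover `F` is injective and commutes with
`z ↦ z + 1`. -/
theorem exists_unique_normalized_lift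
    (α : ℝ) (f : ℂ → ℂ)
    (hfd : DifferentiableOn ℂ f (Metric.ball 0 1))
    (hfi : Set.InjOn f (Metric.ball 0 1))
    (hf0 : f 0 = 0)
    (hf' : deriv f 0 = Complex.exp (2 * Real.pi * Complex.I * α)) :
    ∃ F : ℂ → ℂ,
      IsNormalizedLift α f F ∧
      (∀ F' : ℂ → ℂ, IsNormalizedLift α f F' →
        Set.EqOn F' F {z : ℂ | 0 < z.im}) ∧
      Set.InjOn F {z : ℂ | 0 < z.im} ∧
      ∀ z ∈ {z : ℂ | 0 < z.im}, F (z + 1) = F z + 1 := by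
  have hball : ball (0 : ℂ) 1 ∈ nhds 0 := ball_mem_nhds 0 one_pos
  have hfg (w : ℂ) : w * dslope f 0 w = f w := by
    simpa [hf0] using sub_smul_dslope f 0 w
  have hg0 : ∀ w ∈ ball (0 : ℂ) 1, dslope f 0 w ≠ 0 := by
    intro w hw h
    have hfw := hfg w
    rw [h, mul_zero] at hfw
    obtain rfl : w = 0 := hfi hw (mem_ball_self one_pos) (hfw.symm.trans hf0.symm)
    rw [dslope_same, hf'] at h
    exact Complex.exp_ne_zero _ h
  obtain ⟨h, hd, h0, hexp⟩ :=
    ((Complex.differentiableOn_dslope hball).2 hfd).exists_eqOn_exp_ball one_pos hg0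
      ((dslope_same f 0).trans hf')
  have hpi := Complex.two_pi_I_ne_zero
  set F : ℂ → ℂ := fun z => z + h (E z) / (2 * Real.pi * Complex.I) with hF
  have hEF : ∀ z ∈ {z : ℂ | 0 < z.im}, E (F z) = f (E z) := by
    intro z hz
    rw [hF, E_add, ← hfg, ← hexp _ (E_mem_ball hz)]
    simp only [E]
    rw [mul_div_cancel₀ _ hpi]
  have hlift : IsNormalizedLift α f F := by
    refine ⟨?_, hEF, ?_⟩
    · exact differentiableOn_id.add
        ((hd.comp differentiable_E.differentiableOn fun z hz => E_mem_ball hz).div_const _)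
    · have hlim := (((hd.differentiableAt hball).continuousAt.tendsto.comp
        tendsto_E_comap_im_atTop).div_const (2 * Real.pi * Complex.I)).sub_const (α : ℂ)
      rw [h0, mul_div_cancel_left₀ _ hpi, sub_self] at hlim
      refine (hlim.mono_left inf_le_left).congr fun z => ?_
      simp [hF]
  refine ⟨F, hlift, fun F' hF' => hlift.eqOn hF', ?_, fun z _ => ?_⟩
  · intro z hz w hw hzw
    have hE : E z = E w := hfi (E_mem_ball hz) (E_mem_ball hw)
      (by rw [← hEF z hz, ← hEF w hw, hzw])
    simpa [hF, hE] using hzw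
  · simp only [hF, E_add_one]
    ring
end
end
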